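/- arXiv:1210.7426 — 2 statements merged into one kernel-verified Lean document; each statement's English description precedes it below -/
import Mathlib

section
/- (Theorem 1) Let p be a driving function from the Carathéodory class, C² on 𝔻̄ for each t ∈ [0,T), with p(z,·) continuous on [0,T) for z ∈ 𝔻̄ and p, p' = ∂p/∂z, p'' = ∂²p/∂z² bounded on 𝔻̄ × [0,T). Let f(z,t) solve the Löwner–Kufarev PDE ∂f/∂t = -z·(∂f/∂z)·p(z,t), f(z,0) = z, each f(·,t) univalent on 𝔻 and extended continuously to 𝔻̄, with Ω(t) = f(𝔻,t) and Γ(t) = ∂Ω(t). Let τ : [0,T) → [0,∞) be differentiable with τ(0) = 0 and τ' > 0, and for each t let F(·,τ(t)) be an injective holomorphic map of 𝔻* = {z : |z| > 1} onto the unbounded complementary component Ω*(t) of Γ(t), with Laurent expansion F(z,τ) = e^{-τ}z + b₀(τ) + b₁(τ)z^{-1} + … at ∞, extending continuously to the unit circle 𝕋 with F(𝕋,τ(t)) = f(𝕋,t), and satisfying ∂F(z,t)/∂t = -z·(∂F/∂z)·q(z,t)·τ'(t), where each q(·,t) is holomorphic on 𝔻*, q(z,t) → 1 as z → ∞, and Re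 q(z,t) > 0 on 𝔻*. For each t > 0 let φ_t : ℝ → ℝ be a continuous function with φ_t(φ̃) → φ̃ as t → 0+ and f(e^{iφ_t(φ̃)}, t) = F(e^{iφ̃}, τ(t)) for all φ̃ (the conformal welding of Γ(t)). Then φ_t(φ̃) = φ̃ + 2·Im p(e^{iφ̃},0)·t + o(t) as t → 0+. -/
open Filter Topology Asymptotics

theorem exists_log_of_differentiableOn_ball {G : ℂ → ℂ} {c : ℂ} {r : ℝ} (hr : 0 < r)
    (hd : DifferentiableOn ℂ G (Metric.ball c r)) (hne : ∀ z ∈ Metric.ball c r, G z ≠ 0) :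
    ∃ l : ℂ → ℂ, l c = Complex.log (G c) ∧
      ∀ z ∈ Metric.ball c r, HasDerivAt l (deriv G z / G z) z ∧ Complex.exp (l z) = G z := by
  have hdd : ∀ z ∈ Metric.ball c r, DifferentiableAt ℂ G z := fun z hz =>
    hd.differentiableAt (Metric.isOpen_ball.mem_nhds hz)
  have hder : DifferentiableOn ℂ (fun z => deriv G z / G z) (Metric.ball c r) :=
    (hd.deriv Metric.isOpen_ball).div hd hne
  obtain ⟨l, hl⟩ := hder.isExactOn_ball.with_val_at c (Complex.log (G c))
  obtain ⟨hl0, hl⟩ := hl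
  have h0mem : c ∈ Metric.ball c r := Metric.mem_ball_self hr
  refine ⟨l, hl0, fun z hz => ⟨hl z hz, ?_⟩⟩
  have h1 : G z * Complex.exp (-l z) = G c * Complex.exp (-l c) := by
    refine (Metric.isOpen_ball (x := c) (ε := r)).is_const_of_deriv_eq_zero
      (f := fun z => G z * Complex.exp (-l z)) (convex_ball _ _).isPreconnected ?_ ?_ hz h0mem
    · intro x hx
      exact ((hdd x hx).mul ((hl x hx).differentiableAt.neg.cexp)).differentiableWithinAt
    · intro x hx
      refine ((hdd x hx).hasDerivAt.mul (hl x hx).neg.cexp).deriv.trans ?_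
      have := hne x hx
      simp only [Pi.zero_apply, Pi.neg_apply]
      field_simp
      ring
  rw [hl0, Complex.exp_neg (Complex.log _), Complex.exp_log (hne c h0mem),
    mul_inv_cancel₀ (hne c h0mem), Complex.exp_neg] at h1
  field_simp at h1
  exact h1.symm

/-- For a function `L` holomorphic on the disc with `Im L(0) = 0`, the imaginary part is controlled
in `L²` of the circle by the real part. -/
theorem integral_im_sq_le_integral_re_sq {L : ℂ → ℂ} (hL : DiffContOnCl ℂ L (Metric.ball 0 1))
    (h0 : (L 0).im = 0) :
    ∫ x in (0:ℝ)..2 * Real.pi, (L (Complex.exp (Complex.I * x))).im ^ 2 ≤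
      ∫ x in (0:ℝ)..2 * Real.pi, (L (Complex.exp (Complex.I * x))).re ^ 2 := by
  have hcirc : ∀ x : ℝ, circleMap 0 1 x = Complex.exp (Complex.I * x) := by
    intro x; simp [circleMap, mul_comm]
  have hc : Continuous fun x : ℝ => L (Complex.exp (Complex.I * x)) := by
    refine hL.continuousOn_ball.comp_continuous (by fun_prop) ?_
    intro x
    simp [mul_comm Complex.I, Complex.norm_exp_ofReal_mul_I]
  have hcr : Continuous fun x : ℝ => (L (Complex.exp (Complex.I * x))).re :=
    Complex.continuous_re.comp hc
  have hci : Continuous fun x : ℝ => (L (Complex.exp (Complex.I * x))).im :=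
    Complex.continuous_im.comp hc
  have hcr2 : Continuous fun x : ℝ => (L (Complex.exp (Complex.I * x))).re ^ 2 := hcr.pow 2
  have hci2 : Continuous fun x : ℝ => (L (Complex.exp (Complex.I * x))).im ^ 2 := hci.pow 2
  have hsq : DiffContOnCl ℂ (fun z => L z * L z) (Metric.ball 0 |(1:ℝ)|) := by
    rw [abs_one]; exact hL.smul hL
  have h1 := hsq.circleAverage
  rw [Real.circleAverage_def] at h1
  simp only [hcirc] at h1
  have h2 := congrArg Complex.re h1
  have h3 : (∫ x in (0:ℝ)..2 * Real.pi, L (Complex.exp (Complex.I * x)) *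
      L (Complex.exp (Complex.I * x))).re = ∫ x in (0:ℝ)..2 * Real.pi,
      ((L (Complex.exp (Complex.I * x))).re ^ 2 - (L (Complex.exp (Complex.I * x))).im ^ 2) := by
    have := intervalIntegral.intervalIntegral_re (𝕜 := ℂ)
      (f := fun x : ℝ => L (Complex.exp (Complex.I * x)) * L (Complex.exp (Complex.I * x)))
      (μ := MeasureTheory.volume) (a := 0) (b := 2 * Real.pi)
      ((hc.mul hc).intervalIntegrable _ _)
    simp only [RCLike.re_eq_complex_re] at this
    rw [← this]
    congr 1
    ext x
    simp [Complex.mul_re]; ring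
  rw [Complex.smul_re, h3, intervalIntegral.integral_sub
    (hcr2.intervalIntegrable _ _) (hci2.intervalIntegrable _ _), Complex.mul_re, h0] at h2
  have hpi := Real.pi_pos
  have h4 : 0 ≤ (2 * Real.pi)⁻¹ • ((∫ x in (0:ℝ)..2 * Real.pi, (L (Complex.exp (Complex.I * x))).re ^ 2) -
      ∫ x in (0:ℝ)..2 * Real.pi, (L (Complex.exp (Complex.I * x))).im ^ 2) := by
    rw [h2]; nlinarith [mul_self_nonneg (L 0).re]
  rw [smul_eq_mul] at h4
  have := nonneg_of_mul_nonneg_right h4 (by positivity)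
  linarith

/-- If `Re L = Re E` on the circle, then `Im L + Im E` is controlled in `L²` by `E`. -/
theorem integral_im_add_im_sq_le {L : ℂ → ℂ} (hL : DiffContOnCl ℂ L (Metric.ball 0 1))
    (h0 : (L 0).im = 0) {E : ℝ → ℂ} (hE : Continuous E)
    (hre : ∀ x : ℝ, (L (Complex.exp (Complex.I * x))).re = (E x).re) :
    ∫ x in (0:ℝ)..2 * Real.pi, ((L (Complex.exp (Complex.I * x))).im + (E x).im) ^ 2 ≤
      2 * ∫ x in (0:ℝ)..2 * Real.pi, ‖E x‖ ^ 2 := by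
  have hc : Continuous fun x : ℝ => L (Complex.exp (Complex.I * x)) := by
    refine hL.continuousOn_ball.comp_continuous (by fun_prop) ?_
    intro x
    simp [mul_comm Complex.I, Complex.norm_exp_ofReal_mul_I]
  have hci : Continuous fun x : ℝ => (L (Complex.exp (Complex.I * x))).im :=
    Complex.continuous_im.comp hc
  have hEi : Continuous fun x : ℝ => (E x).im := Complex.continuous_im.comp hE
  have hci2 : Continuous fun x : ℝ => 2 * (L (Complex.exp (Complex.I * x))).im ^ 2 :=
    (hci.pow 2).const_mul 2
  have hEi2 : Continuous fun x : ℝ => 2 * (E x).im ^ 2 := (hEi.pow 2).const_mul 2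
  have h1 := integral_im_sq_le_integral_re_sq hL h0
  simp only [hre] at h1
  have hpi := Real.pi_pos
  calc _ ≤ ∫ x in (0:ℝ)..2 * Real.pi,
        (2 * (L (Complex.exp (Complex.I * x))).im ^ 2 + 2 * (E x).im ^ 2) := by
        refine intervalIntegral.integral_mono_on (by positivity)
          (((hci.add hEi).pow 2).intervalIntegrable _ _)
          ((hci2.add hEi2).intervalIntegrable _ _) fun x _ => ?_
        nlinarith [sq_nonneg ((L (Complex.exp (Complex.I * x))).im - (E x).im)]
    _ = 2 * (∫ x in (0:ℝ)..2 * Real.pi, (L (Complex.exp (Complex.I * x))).im ^ 2) +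
        2 * ∫ x in (0:ℝ)..2 * Real.pi, (E x).im ^ 2 := by
        rw [intervalIntegral.integral_add
          (hci2.intervalIntegrable _ _)
          (hEi2.intervalIntegrable _ _),
          intervalIntegral.integral_const_mul, intervalIntegral.integral_const_mul]
    _ ≤ 2 * (∫ x in (0:ℝ)..2 * Real.pi, (E x).re ^ 2) +
        2 * ∫ x in (0:ℝ)..2 * Real.pi, (E x).im ^ 2 := by gcongr
    _ = 2 * ∫ x in (0:ℝ)..2 * Real.pi, ‖E x‖ ^ 2 := by
        rw [← mul_add, ← intervalIntegral.integral_add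
          ((by fun_prop : Continuous _).intervalIntegrable _ _)
          ((by fun_prop : Continuous _).intervalIntegrable _ _)]
        congr 2
        ext x
        rw [Complex.sq_norm, Complex.normSq_apply]; ring

theorem abs_integral_le_sqrt_mul {g : ℝ → ℝ} (hg : Continuous g) {a s δ : ℝ} (hs : 0 ≤ s)
    (hδ : 0 ≤ δ) (h : ∫ x in a..a + s, g x ^ 2 ≤ δ ^ 2) :
    |∫ x in a..a + s, g x| ≤ √s * δ := by
  rcases hs.eq_or_lt with rfl | hs
  · simp
  set I := ∫ x in a..a + s, g x with hI
  have h1 : 0 ≤ ∫ x in a..a + s, (g x - I / s) ^ 2 :=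
    intervalIntegral.integral_nonneg (by linarith) fun x _ => sq_nonneg _
  have h2 : ∫ x in a..a + s, (g x - I / s) ^ 2 = (∫ x in a..a + s, g x ^ 2) - I ^ 2 / s := by
    have : ∀ x, (g x - I / s) ^ 2 = g x ^ 2 - (2 * (I / s)) * g x + (I / s) ^ 2 := by
      intro x; ring
    simp only [this]
    rw [intervalIntegral.integral_add ((by fun_prop : Continuous _).intervalIntegrable _ _)
      ((by fun_prop : Continuous _).intervalIntegrable _ _), intervalIntegral.integral_sub
      ((by fun_prop : Continuous _).intervalIntegrable _ _)
      ((by fun_prop : Continuous _).intervalIntegrable _ _),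
      intervalIntegral.integral_const_mul, intervalIntegral.integral_const, ← hI]
    simp only [add_sub_cancel_left, smul_eq_mul]
    field_simp
    ring
  have h3 : I ^ 2 / s ≤ δ ^ 2 := by linarith
  rw [div_le_iff₀ hs] at h3
  rw [← Real.sqrt_sq hδ, ← Real.sqrt_mul hs.le]
  apply Real.abs_le_sqrt
  linarith

/-- A pointwise bound for a periodic function from an `L²` bound and an `L²` Lipschitz bound. -/
theorem abs_le_of_integral_sq_le {g : ℝ → ℝ} (hg : Continuous g)
    (hper : Function.Periodic g (2 * Real.pi)) {δ K : ℝ} (hδ : 0 ≤ δ) (hK : 0 ≤ K)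
    (h2 : ∫ x in (0:ℝ)..2 * Real.pi, g x ^ 2 ≤ δ ^ 2)
    (hlip : ∀ h : ℝ, 0 < h →
      ∫ x in (0:ℝ)..2 * Real.pi, (g (x + h) - g x) ^ 2 ≤ (K * h) ^ 2)
    {s : ℝ} (hs : 0 < s) (hs1 : s ≤ 1) (a : ℝ) :
    |g a| ≤ δ / √s + 4 * K * √s := by
  have hpi := Real.pi_gt_three
  have hlocal : ∀ (k : ℝ → ℝ) (r D : ℝ), Continuous k → Function.Periodic k (2 * Real.pi) → 0 ≤ D →
      0 ≤ r → r ≤ 1 → ∫ x in (0:ℝ)..2 * Real.pi, k x ^ 2 ≤ D ^ 2 →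
      |∫ x in a..a + r, k x| ≤ √r * D := by
    intro k r D hk hkper hD hr hr1 hb
    apply abs_integral_le_sqrt_mul hk hr hD
    have hsqper : Function.Periodic (fun x => k x ^ 2) (2 * Real.pi) := fun x => by
      simp only [hkper x]
    have h3 := hsqper.intervalIntegral_add_eq a 0
    rw [zero_add] at h3
    rw [← h3] at hb
    refine le_trans ?_ hb
    refine intervalIntegral.integral_mono_interval le_rfl (by linarith) (by linarith)
      (Eventually.of_forall fun x => sq_nonneg _)
      ((by fun_prop : Continuous _).intervalIntegrable _ _)
  set r : ℕ → ℝ := fun n => s / 2 ^ n with hr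
  have hrpos : ∀ n, 0 < r n := fun n => by positivity
  have hrle : ∀ n, r n ≤ s := fun n => div_le_self hs.le (one_le_pow₀ (by norm_num))
  set D : ℕ → ℝ := fun n => (∫ x in a..a + r n, g x) / r n with hD
  have hstep : ∀ n, dist (D n) (D (n + 1)) ≤ (K * √s) * (3 / 4) ^ n := by
    intro n
    have hrn : r n = 2 * r (n + 1) := by simp only [hr, pow_succ]; field_simp
    set q := r (n + 1) with hq
    have hq0 : 0 < q := hrpos _
    have hsplit : ∫ x in a..a + r n, g x = (∫ x in a..a + q, g x) + ∫ x in a..a + q, g (x + q) := by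
      rw [intervalIntegral.integral_comp_add_right, hrn,
        show a + 2 * q = a + q + q by ring, intervalIntegral.integral_add_adjacent_intervals
          (hg.intervalIntegrable _ _) (hg.intervalIntegrable _ _)]
    have hdiff : D n - D (n + 1) = (∫ x in a..a + q, (g (x + q) - g x)) / (2 * q) := by
      simp only [hD]
      rw [hsplit, hrn, ← hq, intervalIntegral.integral_sub
        ((by fun_prop : Continuous _).intervalIntegrable _ _) (hg.intervalIntegrable _ _)]
      field_simp
      ring
    have hb := hlocal (fun x => g (x + q) - g x) q (K * q) (by fun_prop)
      (fun x => by
        show g (x + 2 * Real.pi + q) - g (x + 2 * Real.pi) = _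
        rw [hper x, show x + 2 * Real.pi + q = x + q + 2 * Real.pi by ring, hper])
      (by positivity) hq0.le ((hrle _).trans hs1) (hlip q hq0)
    rw [Real.dist_eq, hdiff, abs_div, abs_of_pos (by positivity : 0 < 2 * q), div_le_iff₀ (by positivity)]
    refine hb.trans ?_
    have hsq : √q ≤ √s * (3 / 4) ^ n := by
      rw [Real.sqrt_le_left (by positivity), mul_pow, Real.sq_sqrt hs.le, hq]
      simp only [hr]
      rw [div_le_iff₀ (by positivity), mul_assoc]
      refine le_mul_of_one_le_right hs.le ?_
      rw [← pow_mul, mul_comm n 2, pow_mul, pow_succ 2 n, ← mul_assoc, ← mul_pow]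
      have : (1:ℝ) ≤ ((3 / 4) ^ 2 * 2) ^ n := one_le_pow₀ (by norm_num)
      linarith
    calc √q * (K * q) ≤ (√s * (3 / 4) ^ n) * (K * q) := by gcongr
      _ ≤ K * √s * (3 / 4) ^ n * (2 * q) := by
        have : 0 ≤ √s * (3 / 4) ^ n * (K * q) := by positivity
        nlinarith
  have hrlim : Tendsto r atTop (𝓝 0) := by
    have := (tendsto_pow_atTop_nhds_zero_of_lt_one (r := (1/2:ℝ)) (by norm_num) (by norm_num)).const_mul s
    rw [mul_zero] at this
    refine this.congr fun n => ?_
    simp only [hr]; rw [div_pow, one_pow]; ring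
  have hlim : Tendsto D atTop (𝓝 (g a)) := by
    have hder : HasDerivAt (fun u => ∫ x in a..u, g x) (g a) a :=
      intervalIntegral.integral_hasDerivAt_right (hg.intervalIntegrable _ _)
        (hg.stronglyMeasurableAtFilter _ _) hg.continuousAt
    have := hder.tendsto_slope_zero_right
    have h3 : Tendsto r atTop (𝓝[>] 0) :=
      tendsto_nhdsWithin_iff.2 ⟨hrlim, Eventually.of_forall hrpos⟩
    refine (this.comp h3).congr fun n => ?_
    simp [hD, div_eq_inv_mul]
  have hfin := dist_le_of_le_geometric_of_tendsto₀ (3 / 4 : ℝ) (K * √s) (by norm_num) hstep hlim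
  have hD0 : |D 0| ≤ δ / √s := by
    have hb := hlocal g s δ hg hper hδ hs.le hs1 h2
    simp only [hD, hr, pow_zero, div_one, abs_div, abs_of_pos hs]
    rw [div_le_div_iff₀ hs (Real.sqrt_pos.2 hs)]
    calc _ ≤ √s * δ * √s := by gcongr
      _ = δ * (√s * √s) := by ring
      _ = δ * s := by rw [Real.mul_self_sqrt hs.le]
  rw [Real.dist_eq] at hfin
  have : |g a| ≤ |D 0| + |D 0 - g a| := by
    have := abs_sub_abs_le_abs_sub (g a) (D 0)
    rw [abs_sub_comm] at this; linarith
  have h4 : K * √s / (1 - 3 / 4) = 4 * K * √s := by ring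
  linarith

theorem welding_estimate {L P : ℂ → ℂ} {B : ℝ → ℂ} {φ : ℝ → ℝ} {t C δ M : ℝ}
    (ht : 0 < t) (hC : 0 ≤ C) (hδ : 0 ≤ δ) (hM : 0 ≤ M) (hCt : C * t ≤ 1 / 4)
    (hL : DiffContOnCl ℂ L (Metric.ball 0 1)) (hL0 : (L 0).im = 0)
    (hP : DiffContOnCl ℂ P (Metric.ball 0 1)) (hP0 : (P 0).im = 0)
    (hPlip : ∀ x y : ℝ, ‖P (Complex.exp (Complex.I * x)) - P (Complex.exp (Complex.I * y))‖
      ≤ M * |x - y|)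
    (hBlip : ∀ x y : ℝ, ‖B x - B y‖ ≤ C * t * |x - y|)
    (hBbd : ∀ x, ‖B x‖ ≤ C * t)
    (hBP : ∀ x : ℝ, ‖B x + t * P (Complex.exp (Complex.I * x))‖ ≤ t * δ)
    (hφ : Continuous φ) (hφper : ∀ x, φ (x + 2 * Real.pi) = φ x + 2 * Real.pi)
    (hweld : ∀ x : ℝ, Complex.I * φ x + B (φ x) =
      Complex.I * x + (starRingEnd ℂ) (L (Complex.exp (Complex.I * x))))
    {s : ℝ} (hs : 0 < s) (hs1 : s ≤ 1) (x : ℝ) :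
    |φ x - x - 2 * (P (Complex.exp (Complex.I * x))).im * t| ≤
      t * (6 * (δ + 2 * M * C * t) / √s + 4 * (12 * C + 8 * M) * √s) := by
  have hpi := Real.pi_pos
  have hpi4 := Real.pi_lt_four
  have hpi2 := Real.pi_lt_d2
  have hcircle : ∀ K : ℂ → ℂ, DiffContOnCl ℂ K (Metric.ball 0 1) →
      Continuous fun x : ℝ => K (Complex.exp (Complex.I * x)) := by
    intro K hK
    refine hK.continuousOn_ball.comp_continuous (by fun_prop) ?_
    intro x
    simp [mul_comm Complex.I, Complex.norm_exp_ofReal_mul_I]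
  have hBcont : Continuous B := by
    refine (LipschitzWith.of_dist_le_mul (K := (C * t).toNNReal) fun x y => ?_).continuous
    rw [dist_eq_norm, Real.dist_eq, Real.coe_toNNReal _ (by positivity)]
    exact hBlip x y
  have hLc := hcircle L hL
  have hPc := hcircle P hP
  have hre : ∀ x : ℝ, (L (Complex.exp (Complex.I * x))).re = (B (φ x)).re := by
    intro x
    have := congrArg Complex.re (hweld x)
    simp at this; exact this.symm
  have him : ∀ x : ℝ, φ x - x = -((L (Complex.exp (Complex.I * x))).im + (B (φ x)).im) := by
    intro x
    have := congrArg Complex.im (hweld x)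
    simp at this; linarith
  set ψ : ℝ → ℝ := fun x => φ x - x with hψ
  have hψc : Continuous ψ := by fun_prop
  have hψim : ∀ x, ψ x = -((L (Complex.exp (Complex.I * x))).im + (B (φ x)).im) := him
  have hint : ∀ {k : ℝ → ℝ}, Continuous k → IntervalIntegrable k MeasureTheory.volume 0 (2 * Real.pi) :=
    fun hk => hk.intervalIntegrable _ _
  have hmono : ∀ {k l : ℝ → ℝ}, Continuous k → Continuous l → (∀ x, k x ≤ l x) →
      ∫ x in (0:ℝ)..2 * Real.pi, k x ≤ ∫ x in (0:ℝ)..2 * Real.pi, l x := fun hk hl h =>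
    intervalIntegral.integral_mono_on (by positivity) (hint hk) (hint hl) fun x _ => h x
  have hBφ : Continuous fun x => B (φ x) := hBcont.comp hφ
  have haff : ∀ {k : ℝ → ℝ} (a b : ℝ), Continuous k →
      ∫ x in (0:ℝ)..2 * Real.pi, (a + b * k x) = 2 * Real.pi * a + b * ∫ x in (0:ℝ)..2 * Real.pi, k x := by
    intro k a b hk
    rw [intervalIntegral.integral_add (by simp) (hint (by fun_prop)), intervalIntegral.integral_const_mul]
    simp
  -- the `L²` bound for `ψ`
  have hψ2 : ∫ x in (0:ℝ)..2 * Real.pi, ψ x ^ 2 ≤ 4 * Real.pi * (C * t) ^ 2 := by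
    have h1 := integral_im_add_im_sq_le hL hL0 hBφ hre
    have h2 : ∀ x, ψ x ^ 2 = ((L (Complex.exp (Complex.I * x))).im + (B (φ x)).im) ^ 2 := fun x => by
      rw [hψim]; ring
    have h3 := hmono (k := fun x => ‖B (φ x)‖ ^ 2) (l := fun _ => (C * t) ^ 2) (by fun_prop)
      (by fun_prop) fun x => by gcongr; exact hBbd _
    simp only [intervalIntegral.integral_const, sub_zero, smul_eq_mul] at h3
    simp only [h2]
    linarith
  -- the `L²` Lipschitz bound for `ψ`
  have hψlip : ∀ h : ℝ, 0 < h → ∫ x in (0:ℝ)..2 * Real.pi, (ψ (x + h) - ψ x) ^ 2 ≤ (8 * C * t * h) ^ 2 := by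
    intro h hh
    have hrot : DiffContOnCl ℂ (fun w => L (Complex.exp (Complex.I * h) * w)) (Metric.ball 0 1) := by
      refine hL.comp (g := fun w => Complex.exp (Complex.I * h) * w)
        (Differentiable.diffContOnCl (by fun_prop)) fun w hw => ?_
      simpa [mul_comm Complex.I, Complex.norm_exp_ofReal_mul_I] using hw
    have hadd : ∀ x : ℝ, Complex.exp (Complex.I * h) * Complex.exp (Complex.I * x) =
        Complex.exp (Complex.I * ((x + h : ℝ) : ℂ)) := by
      intro x; rw [← Complex.exp_add]; push_cast; ring_nf
    have hE : Continuous fun x => B (φ (x + h)) - B (φ x) := by fun_prop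
    have h1 := integral_im_add_im_sq_le (hrot.sub hL) (by simp) hE (fun x => by
      simp only [Pi.sub_apply, hadd, Complex.sub_re, hre])
    have h2 : ∀ x, (ψ (x + h) - ψ x) ^ 2 =
        (((fun w => L (Complex.exp (Complex.I * h) * w)) - L) (Complex.exp (Complex.I * x))).im ^ 2 * 0 +
        ((((fun w => L (Complex.exp (Complex.I * h) * w)) - L) (Complex.exp (Complex.I * x))).im +
          (B (φ (x + h)) - B (φ x)).im) ^ 2 := fun x => by
      rw [hψim, hψim]
      simp only [Pi.sub_apply, hadd, Complex.sub_im]; ring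
    simp only [mul_zero, zero_add] at h2
    simp only [← h2] at h1
    have h3 := hmono (k := fun x => ‖B (φ (x + h)) - B (φ x)‖ ^ 2)
      (l := fun x => 2 * (C * t) ^ 2 * h ^ 2 + 2 * (C * t) ^ 2 * (ψ (x + h) - ψ x) ^ 2) (by fun_prop)
      (by fun_prop) fun x => by
        have : ‖B (φ (x + h)) - B (φ x)‖ ^ 2 ≤ (C * t * |φ (x + h) - φ x|) ^ 2 := by
          gcongr; exact hBlip _ _
        refine this.trans ?_
        rw [mul_pow, sq_abs]
        have h4 : φ (x + h) - φ x = h + (ψ (x + h) - ψ x) := by simp only [hψ]; ring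
        rw [h4]
        have : 0 ≤ (C * t) ^ 2 * (h - (ψ (x + h) - ψ x)) ^ 2 := by positivity
        nlinarith
    rw [haff _ _ (by fun_prop)] at h3
    set J := ∫ x in (0:ℝ)..2 * Real.pi, (ψ (x + h) - ψ x) ^ 2
    have hJ : 0 ≤ J := intervalIntegral.integral_nonneg (by positivity) fun x _ => sq_nonneg _
    have h5 : (C * t) ^ 2 ≤ (1 / 4) ^ 2 := by gcongr
    have h6 : (C * t) ^ 2 * J ≤ (1 / 4) ^ 2 * J := by gcongr
    have h7 : 0 ≤ (C * t) ^ 2 * h ^ 2 := by positivity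
    have h8 : Real.pi * ((C * t) ^ 2 * h ^ 2) ≤ 4 * ((C * t) ^ 2 * h ^ 2) := by gcongr
    nlinarith
  set g : ℝ → ℝ := fun x => φ x - x - 2 * (P (Complex.exp (Complex.I * x))).im * t with hg
  have hPim : Continuous fun x : ℝ => (P (Complex.exp (Complex.I * x))).im :=
    Complex.continuous_im.comp hPc
  have hgc : Continuous g := by fun_prop
  have hexp : ∀ x : ℝ, Complex.exp (Complex.I * ((x + 2 * Real.pi : ℝ) : ℂ)) =
      Complex.exp (Complex.I * x) := by
    intro x
    push_cast
    rw [mul_add, mul_comm Complex.I (2 * _)]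
    exact Complex.exp_periodic _
  have hgper : Function.Periodic g (2 * Real.pi) := by
    intro x
    simp only [hg, hexp, hφper]; ring
  have hg2 : ∫ x in (0:ℝ)..2 * Real.pi, g x ^ 2 ≤ (t * (6 * (δ + 2 * M * C * t))) ^ 2 := by
    have hE : Continuous fun x : ℝ => B (φ x) + t * P (Complex.exp (Complex.I * x)) :=
      hBφ.add (continuous_const.mul hPc)
    have htP : DiffContOnCl ℂ (fun z => (t:ℂ) * P z) (Metric.ball 0 1) := by
      exact hP.const_smul (t:ℂ)
    have h1 := integral_im_add_im_sq_le (hL.add htP) (by simp [hL0, hP0]) hE (fun x => by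
      simp [hre])
    have h2 : ∀ x : ℝ, ((L + fun z => (t:ℂ) * P z) (Complex.exp (Complex.I * x))).im +
          (B (φ x) + t * P (Complex.exp (Complex.I * x))).im = -g x := fun x => by
      have := him x
      simp only [hg, this]
      simp; ring
    simp only [h2, neg_sq] at h1
    have h3 := hmono (k := fun x => ‖B (φ x) + t * P (Complex.exp (Complex.I * x))‖ ^ 2)
      (l := fun x => 2 * (t * δ) ^ 2 + 2 * (t * M) ^ 2 * ψ x ^ 2) (by fun_prop)
      (by fun_prop) fun x => by
        have h4 : ‖B (φ x) + t * P (Complex.exp (Complex.I * x))‖ ≤ t * δ + t * (M * |ψ x|) := by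
          calc _ = ‖(B (φ x) + t * P (Complex.exp (Complex.I * φ x))) +
                t * (P (Complex.exp (Complex.I * x)) - P (Complex.exp (Complex.I * φ x)))‖ := by
                congr 1; ring
            _ ≤ _ := by
                refine (norm_add_le _ _).trans (add_le_add (hBP _) ?_)
                rw [norm_mul, Complex.norm_real, Real.norm_of_nonneg ht.le]
                have := hPlip x (φ x)
                rw [abs_sub_comm] at this
                gcongr
        have h5 : ‖B (φ x) + t * P (Complex.exp (Complex.I * x))‖ ^ 2 ≤ (t * δ + t * (M * |ψ x|)) ^ 2 := by
          gcongr
        refine h5.trans ?_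
        rw [← sq_abs (ψ x)]
        nlinarith [sq_nonneg (t * δ - t * (M * |ψ x|))]
    rw [haff _ _ (by fun_prop)] at h3
    have h6 : 2 * (t * M) ^ 2 * ∫ x in (0:ℝ)..2 * Real.pi, ψ x ^ 2 ≤
        2 * (t * M) ^ 2 * (4 * Real.pi * (C * t) ^ 2) := by gcongr
    have h7 : 2 * (2 * Real.pi * (2 * (t * δ) ^ 2) + 2 * (t * M) ^ 2 * (4 * Real.pi * (C * t) ^ 2)) =
        8 * Real.pi * t ^ 2 * (δ ^ 2 + 2 * (M * C * t) ^ 2) := by ring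
    have h8 : 8 * Real.pi * t ^ 2 * (δ ^ 2 + 2 * (M * C * t) ^ 2) ≤
        36 * t ^ 2 * (δ ^ 2 + 2 * (M * C * t) ^ 2) := by gcongr; linarith
    have h9 : 0 ≤ t ^ 2 * (δ * (M * C * t)) := by positivity
    have h10 : 0 ≤ t ^ 2 * (M * C * t) ^ 2 := by positivity
    nlinarith
  have hglip : ∀ h : ℝ, 0 < h →
      ∫ x in (0:ℝ)..2 * Real.pi, (g (x + h) - g x) ^ 2 ≤ (t * (12 * C + 8 * M) * h) ^ 2 := by
    intro h hh
    have h3 := hmono (k := fun x => (g (x + h) - g x) ^ 2)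
      (l := fun x => 8 * (t * M * h) ^ 2 + 2 * (ψ (x + h) - ψ x) ^ 2) (by fun_prop)
      (by fun_prop) fun x => by
        set u := (P (Complex.exp (Complex.I * ((x + h : ℝ) : ℂ)))).im -
          (P (Complex.exp (Complex.I * x))).im with hu
        have h4 : g (x + h) - g x = (ψ (x + h) - ψ x) - 2 * t * u := by
          simp only [hg, hψ, hu]; ring
        have h5 : |u| ≤ M * h := by
          have := hPlip (x + h) x
          rw [add_sub_cancel_left, abs_of_pos hh] at this
          rw [hu, ← Complex.sub_im]
          exact (Complex.abs_im_le_norm _).trans this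
        have h6 : u ^ 2 ≤ (M * h) ^ 2 := by
          rw [← sq_abs]; gcongr
        have h7 : t ^ 2 * u ^ 2 ≤ t ^ 2 * (M * h) ^ 2 := by gcongr
        show (g (x + h) - g x) ^ 2 ≤ _
        rw [h4]
        nlinarith [sq_nonneg ((ψ (x + h) - ψ x) + 2 * t * u)]
    rw [haff _ _ (by fun_prop)] at h3
    have h4 := hψlip h hh
    have h5 : Real.pi * (t * M * h) ^ 2 ≤ 4 * (t * M * h) ^ 2 := by gcongr
    have h6 : 0 ≤ (t * h) ^ 2 * (C * M) := by positivity
    have h7 : 0 ≤ (t * h) ^ 2 * C ^ 2 := by positivity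
    nlinarith
  have := abs_le_of_integral_sq_le hgc hgper (by positivity) (by positivity) hg2 hglip hs hs1 x
  refine this.trans (le_of_eq ?_)
  ring

/-- A nonvanishing function on the closed disc has a holomorphic logarithm, continuous up to the
boundary. -/
theorem DiffContOnCl.exists_exp_eq {G : ℂ → ℂ} (hG : DiffContOnCl ℂ G (Metric.ball 0 1))
    (hne : ∀ z ∈ Metric.closedBall (0:ℂ) 1, G z ≠ 0) :
    ∃ L : ℂ → ℂ, DiffContOnCl ℂ L (Metric.ball 0 1) ∧
      L 0 = Complex.log (G 0) ∧ ∀ z ∈ Metric.closedBall (0:ℂ) 1, Complex.exp (L z) = G z := by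
  have hd : DifferentiableOn ℂ G (Metric.ball 0 1) := hG.differentiableOn
  have hcl : ContinuousOn G (Metric.closedBall 0 1) := hG.continuousOn_ball
  have hne' : ∀ z ∈ Metric.ball (0:ℂ) 1, G z ≠ 0 := fun z hz => hne z (Metric.ball_subset_closedBall hz)
  have hdd : ∀ z ∈ Metric.ball (0:ℂ) 1, DifferentiableAt ℂ G z := fun z hz =>
    hd.differentiableAt (Metric.isOpen_ball.mem_nhds hz)
  obtain ⟨l, hl0, hlog⟩ := exists_log_of_differentiableOn_ball one_pos hd hne'
  have hunif : ∃ r : ℝ, 0 < r ∧ r < 1 ∧ ∀ z ∈ Metric.closedBall (0:ℂ) 1,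
      ‖G z / G (r * z) - 1‖ < 1 := by
    obtain ⟨w, hw, hmin⟩ := (isCompact_closedBall (0:ℂ) 1).exists_isMinOn ⟨0, by simp⟩ hcl.norm
    have hc : 0 < ‖G w‖ := norm_pos_iff.2 (hne w hw)
    have huc := (isCompact_closedBall (0:ℂ) 1).uniformContinuousOn_of_continuous hcl
    obtain ⟨d, hd, hdist⟩ := Metric.uniformContinuousOn_iff.1 huc _ hc
    refine ⟨max (1 / 2) (1 - d / 2), by positivity, by apply max_lt <;> linarith, fun z hz => ?_⟩
    set r := max (1 / 2) (1 - d / 2)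
    have hr0 : 0 < r := by positivity
    have hr1 : r < 1 := by apply max_lt <;> linarith
    have hz1 : ‖z‖ ≤ 1 := by simpa using hz
    have hrz : (r:ℂ) * z ∈ Metric.closedBall (0:ℂ) 1 := by
      simp only [mem_closedBall_zero_iff, norm_mul, Complex.norm_real, Real.norm_of_nonneg hr0.le]
      exact mul_le_one₀ hr1.le (norm_nonneg _) hz1
    have h1 := hdist z hz _ hrz (by
      rw [dist_eq_norm, show z - r * z = ((1 - r : ℝ) : ℂ) * z by push_cast; ring, norm_mul,
        Complex.norm_real, Real.norm_of_nonneg (by linarith)]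
      have : 1 - d / 2 ≤ r := le_max_right _ _
      nlinarith [norm_nonneg z])
    have h2 : ‖G w‖ ≤ ‖G (r * z)‖ := hmin hrz
    rw [div_sub_one (hne _ hrz), norm_div, div_lt_one (hc.trans_le h2), ← dist_eq_norm]
    exact h1.trans_le h2
  obtain ⟨r, hr0, hr1, hr⟩ := hunif
  have hmaps : ∀ z ∈ Metric.closedBall (0:ℂ) 1, (r:ℂ) * z ∈ Metric.ball (0:ℂ) 1 := by
    intro z hz
    have hz1 : ‖z‖ ≤ 1 := by simpa using hz
    simp only [mem_ball_zero_iff, norm_mul, Complex.norm_real, Real.norm_of_nonneg hr0.le]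
    nlinarith [norm_nonneg z]
  have hslit : ∀ z ∈ Metric.closedBall (0:ℂ) 1, G z / G (r * z) ∈ Complex.slitPlane := by
    intro z hz
    left
    have h1 := (Complex.abs_re_le_norm (G z / G (r * z) - 1)).trans_lt (hr z hz)
    rw [abs_lt, Complex.sub_re, Complex.one_re] at h1
    linarith [h1.1]
  have hlc : ContinuousOn l (Metric.ball 0 1) := fun z hz => (hlog z hz).1.continuousAt.continuousWithinAt
  refine ⟨fun z => l (r * z) + Complex.log (G z / G (r * z)), ⟨?_, ?_⟩, ?_, ?_⟩
  · intro z hz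
    have hz' := Metric.ball_subset_closedBall hz
    have h1 : DifferentiableAt ℂ (fun z : ℂ => (r:ℂ) * z) z := by fun_prop
    have h2 : DifferentiableAt ℂ (fun z : ℂ => l (r * z)) z :=
      (hlog _ (hmaps z hz')).1.differentiableAt.comp z h1
    have h3 : DifferentiableAt ℂ (fun z : ℂ => G (r * z)) z := (hdd _ (hmaps z hz')).comp z h1
    exact (h2.add (((hdd z hz).div h3 (hne' _ (hmaps z hz'))).clog (hslit z hz'))).differentiableWithinAt
  · rw [closure_ball _ one_ne_zero]
    have h1 : ContinuousOn (fun z : ℂ => (r:ℂ) * z) (Metric.closedBall 0 1) := by fun_prop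
    exact (hlc.comp h1 hmaps).add
      ((hcl.div (hd.continuousOn.comp h1 hmaps) fun z hz => hne' _ (hmaps z hz)).clog hslit)
  · simp [hl0, hne' 0 (Metric.mem_ball_self one_pos)]
  · intro z hz
    have h1 := hne' _ (hmaps z hz)
    show Complex.exp (l (r * z) + Complex.log (G z / G (r * z))) = G z
    rw [Complex.exp_add, (hlog _ (hmaps z hz)).2, Complex.exp_log (div_ne_zero (hne z hz) h1)]
    field_simp

theorem exists_int_lift_of_exp_eq {L : ℂ → ℂ} {B : ℝ → ℂ} {φ : ℝ → ℝ}
    (hL : Continuous fun x : ℝ => L (Complex.exp (Complex.I * x)))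
    (hBlip : ∀ x y : ℝ, ‖B x - B y‖ ≤ 1 / 4 * |x - y|)
    (hBper : Function.Periodic B (2 * Real.pi)) (hφ : Continuous φ)
    (hexp : ∀ x : ℝ, Complex.exp (Complex.I * φ x + B (φ x)) =
      Complex.exp (Complex.I * x + (starRingEnd ℂ) (L (Complex.exp (Complex.I * x))))) :
    ∃ k : ℤ, (∀ x : ℝ, Complex.I * ((φ x - k * (2 * Real.pi) : ℝ) : ℂ) + B (φ x - k * (2 * Real.pi)) =
        Complex.I * x + (starRingEnd ℂ) (L (Complex.exp (Complex.I * x)))) ∧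
      ∀ x, φ (x + 2 * Real.pi) = φ x + 2 * Real.pi := by
  have hpi := Real.pi_pos
  have hBcont : Continuous B := by
    refine (LipschitzWith.of_dist_le_mul (K := 1 / 4) fun x y => ?_).continuous
    rw [dist_eq_norm, Real.dist_eq]
    simpa using hBlip x y
  choose n hn using fun x => Complex.exp_eq_exp_iff_exists_int.1 (hexp x)
  have hncont : Continuous n := by
    rw [Int.isClosedEmbedding_coe_real.isInducing.continuous_iff]
    have : (Int.cast ∘ n : ℝ → ℝ) = fun x => (φ x + (B (φ x)).im - x +
        (L (Complex.exp (Complex.I * x))).im) / (2 * Real.pi) := by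
      ext x
      have := congrArg Complex.im (hn x)
      simp at this
      simp only [Function.comp_apply]
      rw [eq_div_iff (by positivity)]
      linarith
    rw [this]
    have h1 : Continuous fun x => (B (φ x)).im := Complex.continuous_im.comp (hBcont.comp hφ)
    have h2 : Continuous fun x : ℝ => (L (Complex.exp (Complex.I * x))).im :=
      Complex.continuous_im.comp hL
    fun_prop
  have hconst : ∀ x, n x = n 0 := fun x => PreconnectedSpace.constant inferInstance hncont
  refine ⟨n 0, fun x => ?_, fun x => ?_⟩
  · rw [hBper.sub_int_mul_eq]
    have h1 := hn x
    rw [hconst] at h1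
    push_cast
    linear_combination h1
  · have h1 := hn x
    have h2 := hn (x + 2 * Real.pi)
    rw [hconst] at h1 h2
    have h3 : Complex.exp (Complex.I * ((x + 2 * Real.pi : ℝ) : ℂ)) = Complex.exp (Complex.I * x) := by
      push_cast
      rw [mul_add, mul_comm Complex.I (2 * _)]
      exact Complex.exp_periodic _
    rw [h3] at h2
    have h4 := hBlip (φ (x + 2 * Real.pi) - 2 * Real.pi) (φ x)
    rw [hBper.sub_eq] at h4
    have h5 : B (φ (x + 2 * Real.pi)) - B (φ x) =
        -Complex.I * ((φ (x + 2 * Real.pi) - 2 * Real.pi - φ x : ℝ) : ℂ) := by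
      push_cast at h2 ⊢
      linear_combination h2 - h1
    rw [h5, norm_mul, Complex.norm_real, norm_neg, Complex.norm_I, one_mul, Real.norm_eq_abs] at h4
    have h6 : |φ (x + 2 * Real.pi) - 2 * Real.pi - φ x| ≤ 0 := by linarith [abs_nonneg (φ (x + 2 * Real.pi) - 2 * Real.pi - φ x)]
    have := abs_nonpos_iff.1 h6
    linarith

theorem exists_exterior_log {F : ℂ → ℂ} {a : ℝ} {b : ℂ} (ha : 0 < a)
    (hF : DifferentiableOn ℂ F {z | 1 < ‖z‖}) (hFc : ContinuousOn F {z | 1 ≤ ‖z‖})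
    (hexp : Tendsto (fun z => F z - a * z) (Bornology.cobounded ℂ) (𝓝 b))
    (hne : ∀ z, 1 ≤ ‖z‖ → F z ≠ 0) :
    ∃ L : ℂ → ℂ, DiffContOnCl ℂ L (Metric.ball 0 1) ∧ (L 0).im = 0 ∧
      ∀ x : ℝ, F (Complex.exp (Complex.I * x)) = Complex.exp (Complex.I * x +
        (starRingEnd ℂ) (L (Complex.exp (Complex.I * x)))) := by
  set H : ℂ → ℂ := fun w => w * (starRingEnd ℂ) (F ((starRingEnd ℂ) w⁻¹)) with hH
  set G : ℂ → ℂ := Function.update H 0 (a : ℂ) with hG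
  have hGne : ∀ w ≠ 0, G w = H w := fun w hw => Function.update_of_ne hw _ _
  have hG0 : G 0 = a := Function.update_self _ _ _
  have hnorm : ∀ w : ℂ, w ≠ 0 → ‖w‖ ≤ 1 → 1 ≤ ‖(starRingEnd ℂ) w⁻¹‖ := by
    intro w hw h1
    rw [Complex.norm_conj, norm_inv]
    exact (one_le_inv₀ (norm_pos_iff.2 hw)).2 h1
  have hlim : ContinuousAt G 0 := by
    rw [hG, continuousAt_update_same]
    have h1 : Tendsto (fun w : ℂ => (starRingEnd ℂ) w⁻¹) (𝓝[≠] 0) (Bornology.cobounded ℂ) := by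
      rw [← tendsto_norm_atTop_iff_cobounded]
      simp only [Complex.norm_conj]
      rw [tendsto_norm_atTop_iff_cobounded]
      exact tendsto_inv₀_nhdsNE_zero
    have h2 := (Complex.continuous_conj.tendsto b).comp (hexp.comp h1)
    have h3 : Tendsto (fun w : ℂ => w) (𝓝[≠] 0) (𝓝 0) := nhdsWithin_le_nhds
    have h4 := (h3.mul h2).add_const (a : ℂ)
    rw [zero_mul, zero_add] at h4
    refine h4.congr' ?_
    filter_upwards [self_mem_nhdsWithin] with w hw
    have hw : w ≠ 0 := hw
    simp [hH]
    field_simp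
    ring
  have hdiff : DifferentiableOn ℂ G (Metric.ball 0 1) := by
    rw [← Complex.differentiableOn_compl_singleton_and_continuousAt_iff (c := 0)
      (Metric.isOpen_ball.mem_nhds (by simp))]
    refine ⟨fun w hw => ?_, hlim⟩
    have hw0 : w ≠ 0 := hw.2
    have hw1 : ‖w‖ < 1 := by simpa using hw.1
    have hev : G =ᶠ[𝓝 w] H := by
      filter_upwards [isOpen_ne.mem_nhds hw0] with u hu using hGne u hu
    refine (DifferentiableAt.congr_of_eventuallyEq ?_ hev).differentiableWithinAt
    have h1 : 1 < ‖(starRingEnd ℂ) w⁻¹‖ := by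
      rw [Complex.norm_conj, norm_inv]
      exact (one_lt_inv₀ (norm_pos_iff.2 hw0)).2 hw1
    have h2 : DifferentiableAt ℂ F ((starRingEnd ℂ) w⁻¹) :=
      hF.differentiableAt ((isOpen_lt continuous_const continuous_norm).mem_nhds h1)
    have h3 : DifferentiableAt ℂ ((starRingEnd ℂ) ∘ F ∘ (starRingEnd ℂ)) w⁻¹ := by
      have := h2.conj_conj
      simpa using this
    exact differentiableAt_id.mul (h3.comp w (differentiableAt_inv hw0))
  have hcont : ContinuousOn G (Metric.closedBall 0 1) := by
    intro w hw
    by_cases hw0 : w = 0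
    · rw [hw0]; exact hlim.continuousWithinAt
    have hw1 : ‖w‖ ≤ 1 := by simpa using hw
    have h1 : ContinuousWithinAt H (Metric.closedBall 0 1 ∩ {0}ᶜ) w := by
      refine continuousWithinAt_id.mul (Complex.continuous_conj.continuousAt.comp_continuousWithinAt ?_)
      refine ContinuousWithinAt.comp (t := {z | 1 ≤ ‖z‖}) (hFc _ (hnorm w hw0 hw1)) ?_ ?_
      · exact (Complex.continuous_conj.continuousAt.comp (continuousAt_inv₀ hw0)).continuousWithinAt
      · intro u hu
        exact hnorm u hu.2 (by simpa using hu.1)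
    have h2 : ContinuousWithinAt H (Metric.closedBall 0 1) w :=
      (continuousWithinAt_inter (isOpen_ne.mem_nhds hw0)).1 h1
    refine h2.congr_of_eventuallyEq ?_ (hGne w hw0)
    exact mem_nhdsWithin_of_mem_nhds (by
      filter_upwards [isOpen_ne.mem_nhds hw0] with u hu using hGne u hu)
  obtain ⟨L, hL, hL0, hLG⟩ := DiffContOnCl.exists_exp_eq (G := G)
    ⟨hdiff, by rwa [closure_ball _ one_ne_zero]⟩ (by
      intro z hz
      by_cases hz0 : z = 0
      · rw [hz0, hG0]; exact_mod_cast ha.ne'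
      · rw [hGne z hz0]
        have := hne _ (hnorm z hz0 (by simpa using hz))
        simpa [hH, hz0] using this)
  refine ⟨L, hL, ?_, fun x => ?_⟩
  · rw [hL0, hG0, ← Complex.ofReal_log ha.le, Complex.ofReal_im]
  · set w := Complex.exp (Complex.I * x) with hw
    have hn : ‖w‖ = 1 := by simp [hw, mul_comm Complex.I, Complex.norm_exp_ofReal_mul_I]
    have hw0 : w ≠ 0 := Complex.exp_ne_zero _
    have hconj : (starRingEnd ℂ) w⁻¹ = w := by
      rw [Complex.inv_eq_conj hn, Complex.conj_conj]
    have hmul : w * (starRingEnd ℂ) w = 1 := by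
      rw [Complex.mul_conj, Complex.normSq_eq_norm_sq, hn]; simp
    rw [Complex.exp_add, ← hw, Complex.exp_conj, hLG w (by simp [hn]), hGne w hw0]
    simp only [hH, hconj, map_mul, Complex.conj_conj]
    rw [← mul_assoc, hmul, one_mul]

theorem zero_notMem_of_unbounded_component {f : ℂ → ℂ}
    (hf : DifferentiableOn ℂ f (Metric.ball 0 1)) (hinj : Set.InjOn f (Metric.ball 0 1))
    (hc : ContinuousOn f (Metric.closedBall 0 1)) (h0 : f 0 = 0) {x : ℂ}
    (hx : ¬ Bornology.IsBounded (connectedComponentIn (f '' Metric.sphere (0:ℂ) 1)ᶜ x)) :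
    (0:ℂ) ∉ connectedComponentIn (f '' Metric.sphere (0:ℂ) 1)ᶜ x := by
  intro hmem
  have hU : IsOpen (f '' Metric.ball 0 1) := by
    rcases (hf.analyticOnNhd Metric.isOpen_ball).is_constant_or_isOpen
      (convex_ball _ _).isPreconnected with ⟨w, hw⟩ | h
    · exfalso
      have h1 : (0:ℂ) ∈ Metric.ball (0:ℂ) 1 := by simp
      have h2 : (1/2:ℂ) ∈ Metric.ball (0:ℂ) 1 := by simp; norm_num
      have := hinj h1 h2 ((hw _ h1).trans (hw _ h2).symm)
      norm_num at this
    · exact h _ subset_rfl Metric.isOpen_ball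
  have hK : IsCompact (f '' Metric.closedBall 0 1) := (isCompact_closedBall _ _).image_of_continuousOn hc
  have hpre := isPreconnected_connectedComponentIn (x := x) (F := (f '' Metric.sphere (0:ℂ) 1)ᶜ)
  have hcover : connectedComponentIn (f '' Metric.sphere (0:ℂ) 1)ᶜ x ⊆
      f '' Metric.ball 0 1 ∪ (f '' Metric.closedBall 0 1)ᶜ := by
    intro y hy
    have hy' := connectedComponentIn_subset _ _ hy
    by_cases h : y ∈ f '' Metric.closedBall 0 1
    · left
      rw [← Metric.ball_union_sphere, Set.image_union] at h
      exact h.resolve_right hy'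
    · exact Or.inr h
  obtain ⟨y, hy, hyK⟩ : ∃ y ∈ connectedComponentIn (f '' Metric.sphere (0:ℂ) 1)ᶜ x,
      y ∉ f '' Metric.closedBall 0 1 := by
    by_contra! h
    exact hx (hK.isBounded.subset h)
  obtain ⟨z, -, hz1, hz2⟩ := hpre _ _ hU hK.isClosed.isOpen_compl hcover
    ⟨0, hmem, 0, by simp, h0⟩ ⟨y, hy, hyK⟩
  exact hz2 (Set.image_mono Metric.ball_subset_closedBall hz1)

/-- A form of Bloch's theorem. -/
theorem exists_ball_subset_image_of_differentiableOn {h : ℂ → ℂ} {a : ℂ} {R : ℝ} (hR : 0 < R)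
    (hd : DifferentiableOn ℂ h (Metric.ball a R)) :
    ∃ b ∈ Metric.ball a R,
      Metric.ball (h b) (R * ‖deriv h a‖ / 128) ⊆ h '' Metric.ball a R := by
  rcases eq_or_ne (deriv h a) 0 with h0 | h0
  · exact ⟨a, Metric.mem_ball_self hR, by simp [h0]⟩
  have hdd : DifferentiableOn ℂ (deriv h) (Metric.ball a R) := hd.deriv Metric.isOpen_ball
  have hsub : Metric.closedBall a (R / 2) ⊆ Metric.ball a R :=
    Metric.closedBall_subset_ball (by linarith)
  have hcont : ContinuousOn (fun z => (R / 2 - dist z a) * ‖deriv h z‖)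
      (Metric.closedBall a (R / 2)) :=
    (by fun_prop : Continuous fun z => R / 2 - dist z a).continuousOn.mul
      (hdd.continuousOn.mono hsub).norm
  obtain ⟨b, hb, hmax⟩ := (isCompact_closedBall a (R / 2)).exists_isMaxOn
    ⟨a, Metric.mem_closedBall_self (by linarith)⟩ hcont
  have hmax' : ∀ z ∈ Metric.closedBall a (R / 2), (R / 2 - dist z a) * ‖deriv h z‖ ≤
      (R / 2 - dist b a) * ‖deriv h b‖ := fun z hz => hmax hz
  have ha := hmax' a (Metric.mem_closedBall_self (by linarith))
  rw [dist_self, sub_zero] at ha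
  have hpos : 0 < R / 2 * ‖deriv h a‖ := by positivity
  have hΛ0 : 0 < ‖deriv h b‖ := by
    refine (norm_nonneg _).lt_of_ne fun h => ?_
    rw [← h, mul_zero] at ha
    linarith
  have hb' : dist b a < R / 2 := by
    by_contra! hc
    nlinarith
  obtain ⟨ρ, hρ⟩ : ∃ ρ, ρ = (R / 2 - dist b a) / 2 := ⟨_, rfl⟩
  obtain ⟨Λ, hΛ⟩ : ∃ Λ, Λ = ‖deriv h b‖ := ⟨_, rfl⟩
  have hρ0 : 0 < ρ := by linarith
  rw [← hΛ] at hΛ0 ha hmax'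
  have hρΛ : R * ‖deriv h a‖ / 128 ≤ 5 / 64 * Λ * ρ / 2 := by
    rw [show R / 2 - dist b a = 2 * ρ by linarith] at ha
    nlinarith
  have hbound : ∀ z ∈ Metric.ball b ρ, ‖deriv h z‖ ≤ 2 * Λ := by
    intro z hz
    rw [Metric.mem_ball] at hz
    have h1 := dist_triangle z b a
    have h2 := hmax' z (by rw [Metric.mem_closedBall]; linarith)
    have h3 : ρ * ‖deriv h z‖ ≤ (R / 2 - dist z a) * ‖deriv h z‖ :=
      mul_le_mul_of_nonneg_right (by linarith) (norm_nonneg _)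
    have h4 : (R / 2 - dist b a) * Λ = ρ * (2 * Λ) := by rw [hρ]; ring
    exact le_of_mul_le_mul_left (by linarith) hρ0
  have hsubρ : Metric.ball b ρ ⊆ Metric.ball a R := by
    intro z hz
    rw [Metric.mem_ball] at hz ⊢
    linarith [dist_triangle z b a]
  have hdiff : ∀ z ∈ Metric.ball b ρ, DifferentiableAt ℂ h z := fun z hz =>
    hd.differentiableAt (Metric.isOpen_ball.mem_nhds (hsubρ hz))
  have hosc : ∀ z ∈ Metric.ball b ρ, ‖deriv h z - deriv h b‖ ≤ 3 * Λ / ρ * ‖z - b‖ := by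
    intro z hz
    rw [← dist_eq_norm, ← dist_eq_norm]
    refine Complex.dist_le_div_mul_dist_of_mapsTo_ball (hdd.mono hsubρ) ?_ hz
    intro w hw
    rw [Metric.mem_closedBall, dist_eq_norm]
    exact (norm_sub_le _ _).trans (by linarith [hbound w hw])
  have hsub8 : Metric.closedBall b (ρ / 8) ⊆ Metric.ball b ρ :=
    Metric.closedBall_subset_ball (by linarith)
  have hlow : ∀ z ∈ Metric.closedBall b (ρ / 8), 5 / 8 * Λ * ‖z - b‖ ≤ ‖h z - h b‖ := by
    intro z hz
    have h1 := (convex_closedBall b (ρ / 8)).norm_image_sub_le_of_norm_hasDerivWithin_le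
      (f := fun z => h z - deriv h b * z) (f' := fun z => deriv h z - deriv h b) (C := 3 / 8 * Λ)
      (fun w hw => ((hdiff w (hsub8 hw)).hasDerivAt.sub
        (by simpa using (hasDerivAt_id w).const_mul (deriv h b))).hasDerivWithinAt)
      (fun w hw => by
        refine (hosc w (hsub8 hw)).trans ?_
        rw [Metric.mem_closedBall, dist_eq_norm] at hw
        have : 3 * Λ / ρ * ‖w - b‖ ≤ 3 * Λ / ρ * (ρ / 8) := by gcongr
        refine this.trans (le_of_eq ?_)
        field_simp)
      (Metric.mem_closedBall_self (by linarith)) hz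
    have h2 : ‖deriv h b * (z - b)‖ = Λ * ‖z - b‖ := by rw [norm_mul, hΛ]
    have h3 : deriv h b * (z - b) = (h z - h b) - (h z - deriv h b * z - (h b - deriv h b * b)) := by
      ring
    have h4 := norm_sub_le (h z - h b) (h z - deriv h b * z - (h b - deriv h b * b))
    rw [← h3, h2] at h4
    linarith
  refine ⟨b, hsub hb, ?_⟩
  have hfreq : ∃ᶠ z in 𝓝 b, h z ≠ h b := by
    intro hev
    have hev' : h =ᶠ[𝓝 b] fun _ => h b := hev.mono fun z hz => not_not.1 hz
    have := hev'.deriv_eq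
    rw [deriv_const] at this
    rw [hΛ, this, norm_zero] at hΛ0
    exact lt_irrefl _ hΛ0
  have himg := DiffContOnCl.ball_subset_image_closedBall (f := h) (z₀ := b) (r := ρ / 8)
    (ε := 5 / 64 * Λ * ρ)
    ⟨fun z hz => (hdiff z (hsub8 (Metric.ball_subset_closedBall hz))).differentiableWithinAt,
      fun z hz => (hdiff z (hsub8 (Metric.closure_ball_subset_closedBall hz))
        ).continuousAt.continuousWithinAt⟩ (by linarith)
    (fun z hz => by
      refine le_trans (le_of_eq ?_) (hlow z (Metric.sphere_subset_closedBall hz))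
      rw [mem_sphere_iff_norm] at hz
      rw [hz]; ring) hfreq
  exact (Metric.ball_subset_ball hρΛ).trans (himg.trans (Set.image_mono (hsub8.trans hsubρ)))

theorem norm_deriv_mul_le_of_injOn {g : ℂ → ℂ} {a : ℂ} {R : ℝ} (hR : 0 < R)
    (hd : DifferentiableOn ℂ g (Metric.ball a R)) (hinj : Set.InjOn g (Metric.ball a R))
    (hne : ∀ z ∈ Metric.ball a R, g z ≠ 0) :
    ‖deriv g a‖ ≤ 256 * Real.pi / R * ‖g a‖ := by
  have ha := Metric.mem_ball_self (x := a) hR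
  obtain ⟨l, -, hl⟩ := exists_log_of_differentiableOn_ball hR hd hne
  obtain ⟨b, hb, hsub⟩ := exists_ball_subset_image_of_differentiableOn (h := l) hR
    fun z hz => (hl z hz).1.differentiableAt.differentiableWithinAt
  rw [(hl a ha).1.deriv, norm_div] at hsub
  by_contra! hc
  have hga : 0 < ‖g a‖ := norm_pos_iff.2 (hne a ha)
  have hlt : 2 * Real.pi < R * (‖deriv g a‖ / ‖g a‖) / 128 := by
    rw [div_mul_eq_mul_div, div_lt_iff₀ hR] at hc
    rw [lt_div_iff₀ (by norm_num), ← mul_div_assoc, lt_div_iff₀ hga]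
    linarith
  obtain ⟨w, hw, hlw⟩ := hsub (show l b + 2 * Real.pi * Complex.I ∈ _ by
    rw [mem_ball_iff_norm, add_sub_cancel_left]
    simpa [abs_of_pos Real.pi_pos] using hlt)
  have h1 : g w = g b := by
    rw [← (hl w hw).2, ← (hl b hb).2, hlw, Complex.exp_periodic]
  rw [hinj hw hb h1, left_eq_add] at hlw
  simp [Real.pi_ne_zero] at hlw

/-- A univalent function on the unit disk fixing the origin is bounded on a smaller disk by a
multiple of its value at one point of the bounding circle. -/
theorem exists_norm_le_mul_norm_of_injOn {ρ : ℝ} (hρ0 : 0 < ρ) (hρ1 : ρ < 1) :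
    ∃ K : ℝ, 0 ≤ K ∧ ∀ f : ℂ → ℂ, DifferentiableOn ℂ f (Metric.ball 0 1) →
      Set.InjOn f (Metric.ball 0 1) → f 0 = 0 →
      ∀ z ∈ Metric.closedBall (0:ℂ) ρ, ‖f z‖ ≤ K * ‖f ρ‖ := by
  obtain ⟨R, hR⟩ : ∃ R, R = min ρ (1 - ρ) := ⟨_, rfl⟩
  have hR0 : 0 < R := by rw [hR]; exact lt_min hρ0 (by linarith)
  refine ⟨Real.exp (ρ * (256 * Real.pi / R) * (2 * Real.pi)), (Real.exp_pos _).le,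
    fun f hd hinj h0 => ?_⟩
  have hder : ∀ z : ℂ, ‖z‖ = ρ → ‖deriv f z‖ ≤ 256 * Real.pi / R * ‖f z‖ := by
    intro z hz
    have hsub : Metric.ball z R ⊆ Metric.ball 0 1 := by
      intro w hw
      rw [mem_ball_iff_norm] at hw
      rw [mem_ball_zero_iff]
      have h1 := norm_add_le z (w - z)
      rw [add_sub_cancel, hz] at h1
      linarith [min_le_right ρ (1 - ρ)]
    refine norm_deriv_mul_le_of_injOn hR0 (hd.mono hsub) (hinj.mono hsub) fun w hw hw0 => ?_
    have hw' := hinj (hsub hw) (by simp) (hw0.trans h0.symm)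
    rw [hw', mem_ball_iff_norm, zero_sub, norm_neg, hz] at hw
    linarith [min_le_left ρ (1 - ρ)]
  have hnorm : ∀ x : ℝ, ‖(ρ:ℂ) * Complex.exp (x * Complex.I)‖ = ρ := fun x => by
    rw [norm_mul, Complex.norm_exp_ofReal_mul_I, mul_one, Complex.norm_real,
      Real.norm_of_nonneg hρ0.le]
  have hmem : ∀ x : ℝ, (ρ:ℂ) * Complex.exp (x * Complex.I) ∈ Metric.ball (0:ℂ) 1 := fun x => by
    rw [mem_ball_zero_iff, hnorm]; exact hρ1
  have hk : ∀ x : ℝ, HasDerivAt (fun x : ℝ => f (ρ * Complex.exp (x * Complex.I)))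
      (deriv f (ρ * Complex.exp (x * Complex.I)) * (ρ * (Complex.exp (x * Complex.I) * Complex.I)))
      x := by
    intro x
    have h1 : HasDerivAt (fun x : ℝ => (ρ:ℂ) * Complex.exp (x * Complex.I))
        (ρ * (Complex.exp (x * Complex.I) * Complex.I)) x := by
      simpa using (((Complex.ofRealCLM.hasDerivAt (x := x)).mul_const Complex.I).cexp).const_mul
        (ρ:ℂ)
    exact (hd.differentiableAt (Metric.isOpen_ball.mem_nhds (hmem x))).hasDerivAt.comp x h1
  have hcirc : ∀ x ∈ Set.Icc 0 (2 * Real.pi), ‖f (ρ * Complex.exp (x * Complex.I))‖ ≤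
      Real.exp (ρ * (256 * Real.pi / R) * (2 * Real.pi)) * ‖f ρ‖ := by
    intro x hx
    have h1 := norm_le_gronwallBound_of_norm_deriv_right_le
      (f := fun x : ℝ => f (ρ * Complex.exp (x * Complex.I))) (δ := ‖f ρ‖)
      (K := ρ * (256 * Real.pi / R)) (ε := 0) (a := 0) (b := 2 * Real.pi)
      (fun y _ => (hk y).continuousAt.continuousWithinAt) (fun y _ => (hk y).hasDerivWithinAt)
      (by simp) (fun y _ => by
        rw [norm_mul, ← mul_assoc (ρ:ℂ), norm_mul (_ * _), Complex.norm_I, hnorm, mul_one, add_zero]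
        calc _ ≤ 256 * Real.pi / R * ‖f (ρ * Complex.exp (y * Complex.I))‖ * ρ := by
              gcongr; exact hder _ (hnorm y)
          _ = _ := by ring) x hx
    rw [gronwallBound_ε0, sub_zero] at h1
    refine h1.trans ?_
    rw [mul_comm]
    gcongr
    exact hx.2
  intro z hz
  have hsub : Metric.closedBall (0:ℂ) ρ ⊆ Metric.ball 0 1 := Metric.closedBall_subset_ball hρ1
  refine Complex.norm_le_of_forall_mem_frontier_norm_le (U := Metric.ball 0 ρ) Metric.isBounded_ball
    ⟨hd.mono (Metric.ball_subset_closedBall.trans hsub), ?_⟩ ?_ ?_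
  · rw [closure_ball _ hρ0.ne']
    exact hd.continuousOn.mono hsub
  · intro w hw
    rw [frontier_ball _ hρ0.ne', mem_sphere_zero_iff_norm] at hw
    have h1 := hcirc (toIcoMod Real.two_pi_pos 0 w.arg) (by
      have := toIcoMod_mem_Ico Real.two_pi_pos 0 w.arg
      rw [zero_add] at this
      exact ⟨this.1, this.2.le⟩)
    have h2 : (ρ:ℂ) * Complex.exp ((toIcoMod Real.two_pi_pos 0 w.arg : ℝ) * Complex.I) = w := by
      rw [← self_sub_toIcoDiv_zsmul, zsmul_eq_mul]
      push_cast
      rw [show ((w.arg : ℂ) - (toIcoDiv Real.two_pi_pos 0 w.arg : ℂ) * (2 * Real.pi)) * Complex.I =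
        w.arg * Complex.I - (toIcoDiv Real.two_pi_pos 0 w.arg : ℂ) * (2 * Real.pi * Complex.I) by
          ring, Complex.exp_sub, Complex.exp_int_mul_two_pi_mul_I, div_one, ← hw,
        Complex.norm_mul_exp_arg_mul_I]
    rwa [h2] at h1
  · rwa [closure_ball _ hρ0.ne']

theorem hasDerivWithinAt_comp_of_norm_le {f : ℂ → ℝ → ℂ} {w : ℝ → ℂ} {S : Set ℝ} {s₀ : ℝ}
    (hs₀ : s₀ ∈ S) {d N : ℝ} (hd : 0 < d)
    (hhol : ∀ s ∈ S, DifferentiableOn ℂ (fun z => f z s) (Metric.ball (w s₀) d))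
    (hN : ∀ s ∈ S, ∀ z ∈ Metric.ball (w s₀) d, ‖f z s‖ ≤ N)
    (hcont : ∀ z ∈ Metric.ball (w s₀) d, ContinuousWithinAt (fun s => f z s) S s₀) {ft w' : ℂ}
    (hft : HasDerivWithinAt (fun s => f (w s₀) s) ft S s₀) (hw : HasDerivWithinAt w w' S s₀) :
    HasDerivWithinAt (fun s => f (w s) s) (deriv (fun z => f z s₀) (w s₀) * w' + ft) S s₀ := by
  obtain ⟨g, hg⟩ : ∃ g : ℝ → ℂ → ℂ, g = fun s => dslope (fun z => f z s) (w s₀) := ⟨_, rfl⟩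
  have hmem := Metric.mem_ball_self (x := w s₀) hd
  have hN0 : 0 ≤ N := (norm_nonneg _).trans (hN s₀ hs₀ _ hmem)
  have hlip : ∀ s ∈ S, ∀ z ∈ Metric.ball (w s₀) d,
      dist (g s z) (g s (w s₀)) ≤ 4 * N / d / d * dist z (w s₀) := by
    intro s hs z hz
    have hb : ∀ z ∈ Metric.ball (w s₀) d, ‖g s z‖ ≤ 2 * N / d := by
      intro z hz
      rw [hg]
      refine Complex.norm_dslope_le_div_of_mapsTo_ball (hhol s hs) (fun y hy => ?_) hz
      rw [Metric.mem_closedBall, dist_eq_norm]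
      exact (norm_sub_le _ _).trans (by linarith [hN s hs y hy, hN s hs _ hmem])
    refine Complex.dist_le_div_mul_dist_of_mapsTo_ball ?_ (fun y hy => ?_) hz
    · rw [hg]
      exact (Complex.differentiableOn_dslope (Metric.isOpen_ball.mem_nhds hmem)).2 (hhol s hs)
    · rw [Metric.mem_closedBall, dist_eq_norm]
      refine (norm_sub_le _ _).trans ((add_le_add (hb y hy) (hb _ hmem)).trans (le_of_eq ?_))
      ring
  have hwc : Tendsto w (𝓝[S] s₀) (𝓝 (w s₀)) := hw.continuousWithinAt
  have hG : Tendsto (fun s => g s (w s)) (𝓝[S] s₀) (𝓝 (g s₀ (w s₀))) := by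
    rw [Metric.tendsto_nhds]
    intro ε hε
    obtain ⟨η, hη⟩ : ∃ η, η = min (d / 2) (ε / (4 * (4 * N / d / d + 1))) := ⟨_, rfl⟩
    have hC : 0 ≤ 4 * N / d / d := by positivity
    have hη0 : 0 < η := by rw [hη]; positivity
    have hηd : η < d := hη ▸ (min_le_left _ _).trans_lt (by linarith)
    have hηε : 4 * N / d / d * η ≤ ε / 4 := by
      have h1 : η ≤ ε / (4 * (4 * N / d / d + 1)) := hη ▸ min_le_right _ _
      rw [le_div_iff₀ (by positivity)] at h1
      nlinarith
    have hz : w s₀ + η ∈ Metric.ball (w s₀) d := by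
      simpa [abs_of_pos hη0] using hηd
    have hzne : w s₀ + η ≠ w s₀ := by simpa using hη0.ne'
    have hzdist : dist (w s₀ + η) (w s₀) = η := by simp [abs_of_pos hη0]
    have hgz : Tendsto (fun s => g s (w s₀ + η)) (𝓝[S] s₀) (𝓝 (g s₀ (w s₀ + η))) := by
      have h1 : ∀ s, g s (w s₀ + η) =
          (w s₀ + η - w s₀)⁻¹ * (f (w s₀ + η) s - f (w s₀) s) := fun s => by
        rw [hg]
        simp only [dslope_of_ne _ hzne, slope_def_module, smul_eq_mul]
      simp only [h1]
      exact ((hcont _ hz).sub (hcont _ hmem)).const_mul _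
    filter_upwards [self_mem_nhdsWithin, Metric.tendsto_nhds.1 hgz (ε / 4) (by positivity),
      Metric.tendsto_nhds.1 hwc η hη0] with s hs h1 h2
    have h3 := hlip s hs (w s) (h2.trans hηd)
    have h4 := hlip s hs _ hz
    have h5 := hlip s₀ hs₀ _ hz
    rw [hzdist] at h4 h5
    have h6 : 4 * N / d / d * dist (w s) (w s₀) ≤ 4 * N / d / d * η := by gcongr
    have t1 := dist_triangle4 (g s (w s)) (g s (w s₀)) (g s (w s₀ + η)) (g s₀ (w s₀ + η))
    have t2 := dist_triangle (g s (w s)) (g s₀ (w s₀ + η)) (g s₀ (w s₀))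
    rw [dist_comm (g s (w s₀)) (g s (w s₀ + η))] at t1
    linarith
  have hgw : g s₀ (w s₀) = deriv (fun z => f z s₀) (w s₀) := by rw [hg]; exact dslope_same _ _
  have hmain : HasDerivWithinAt (fun s => g s (w s) * (w s - w s₀)) (g s₀ (w s₀) * w') S s₀ := by
    rw [hasDerivWithinAt_iff_tendsto_slope] at hw ⊢
    refine ((hG.mono_left (nhdsWithin_mono _ Set.sdiff_subset)).mul hw).congr fun s => ?_
    simp only [slope_def_module, sub_self, mul_zero, sub_zero, Complex.real_smul]
    ring
  rw [← hgw]
  refine (hmain.add hft).congr (fun s _ => ?_) ?_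
  · have := sub_smul_dslope (fun z => f z s) (w s₀) (w s)
    rw [smul_eq_mul] at this
    simp only [hg, Pi.add_apply]
    rw [mul_comm, this, sub_add_cancel]
  · simp

/-- Solutions of the Löwner–Kufarev equation are constant along its characteristics. -/
theorem eq_of_characteristic {T t r : ℝ} {p f fz : ℂ → ℝ → ℂ} (htT : t < T) (hr : r < 1)
    (hf_init : ∀ z ∈ Metric.ball (0:ℂ) 1, f z 0 = z)
    (hf_hol : ∀ t ∈ Set.Ico (0:ℝ) T,
      DifferentiableOn ℂ (fun z => f z t) (Metric.ball (0:ℂ) 1))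
    (hf_inj : ∀ t ∈ Set.Ico (0:ℝ) T,
      Set.InjOn (fun z => f z t) (Metric.ball (0:ℂ) 1))
    (hfz : ∀ t ∈ Set.Ico (0:ℝ) T, ∀ z ∈ Metric.ball (0:ℂ) 1,
      HasDerivAt (fun x => f x t) (fz z t) z)
    (hf_pde : ∀ z ∈ Metric.ball (0:ℂ) 1, ∀ t ∈ Set.Ico (0:ℝ) T,
      HasDerivWithinAt (fun u => f z u) (-(z * fz z t * p z t)) (Set.Ico 0 T) t)
    (hf_zero : ∀ t ∈ Set.Ico (0:ℝ) T, f 0 t = 0)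
    {w : ℝ → ℂ} (hwr : ∀ s ∈ Set.Icc 0 t, ‖w s‖ ≤ r)
    (hw : ∀ s ∈ Set.Icc 0 t, HasDerivWithinAt w (w s * p (w s) s) (Set.Icc 0 t) s) (ht : 0 ≤ t) :
    f (w t) t = w 0 := by
  have h0 : (0:ℝ) ∈ Set.Icc 0 t := ⟨le_rfl, ht⟩
  have hr0 : 0 ≤ r := (norm_nonneg _).trans (hwr 0 h0)
  have hI : Set.Icc 0 t ⊆ Set.Ico 0 T := fun s hs => ⟨hs.1, hs.2.trans_lt htT⟩
  obtain ⟨ρ, hrρ, hρ1⟩ := exists_between hr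
  have hρ0 : 0 < ρ := hr0.trans_lt hrρ
  obtain ⟨K, hK0, hK⟩ := exists_norm_le_mul_norm_of_injOn hρ0 hρ1
  have hcont : ∀ z ∈ Metric.ball (0:ℂ) 1, ContinuousOn (fun s => f z s) (Set.Icc 0 t) :=
    fun z hz s hs => ((hf_pde z hz s (hI hs)).mono hI).continuousWithinAt
  have hρmem : (ρ:ℂ) ∈ Metric.ball (0:ℂ) 1 := by simpa [abs_of_pos hρ0] using hρ1
  obtain ⟨N, hN⟩ := isCompact_Icc.exists_bound_of_continuousOn (hcont ρ hρmem)
  have hbd : ∀ s ∈ Set.Icc 0 t, ∀ z ∈ Metric.closedBall (0:ℂ) ρ, ‖f z s‖ ≤ K * N :=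
    fun s hs z hz => (hK _ (hf_hol s (hI hs)) (hf_inj s (hI hs)) (hf_zero s (hI hs)) z hz).trans
      (mul_le_mul_of_nonneg_left (hN s hs) hK0)
  have hsub : ∀ s ∈ Set.Icc 0 t, Metric.ball (w s) (ρ - r) ⊆ Metric.closedBall 0 ρ := by
    intro s hs z hz
    rw [mem_ball_iff_norm] at hz
    rw [mem_closedBall_zero_iff]
    have := norm_add_le (w s) (z - w s)
    rw [add_sub_cancel] at this
    linarith [hwr s hs]
  have hsub1 : Metric.closedBall (0:ℂ) ρ ⊆ Metric.ball 0 1 := Metric.closedBall_subset_ball hρ1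
  have hd : ∀ s ∈ Set.Icc 0 t, HasDerivWithinAt (fun s => f (w s) s) 0 (Set.Icc 0 t) s := by
    intro s hs
    have hws : w s ∈ Metric.ball (0:ℂ) 1 := by
      rw [mem_ball_zero_iff]; exact (hwr s hs).trans_lt hr
    have := hasDerivWithinAt_comp_of_norm_le hs (sub_pos.2 hrρ)
      (fun u hu => (hf_hol u (hI hu)).mono ((hsub s hs).trans hsub1))
      (fun u hu z hz => hbd u hu z (hsub s hs hz))
      (fun z hz => hcont z (hsub1 (hsub s hs hz)) s hs)
      ((hf_pde (w s) hws s (hI hs)).mono hI) (hw s hs)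
    rw [(hfz s (hI hs) _ hws).deriv] at this
    convert this using 1
    ring
  have := constant_of_has_deriv_right_zero (fun s hs => (hd s hs).continuousWithinAt)
    (fun s hs => (hd s ⟨hs.1, hs.2.le⟩).mono_of_mem_nhdsWithin (Icc_mem_nhdsGE_of_mem hs)) t ⟨ht, le_rfl⟩
  refine this.trans (hf_init _ ?_)
  rw [mem_ball_zero_iff]; exact (hwr 0 h0).trans_lt hr

theorem loewner_kufarev_map_zero {T : ℝ} {p f fz : ℂ → ℝ → ℂ}
    (hf_init : ∀ z ∈ Metric.ball (0:ℂ) 1, f z 0 = z)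
    (hf_pde : ∀ z ∈ Metric.ball (0:ℂ) 1, ∀ t ∈ Set.Ico (0:ℝ) T,
      HasDerivWithinAt (fun u => f z u) (-(z * fz z t * p z t)) (Set.Ico 0 T) t)
    {t : ℝ} (ht : t ∈ Set.Ico 0 T) : f 0 t = 0 := by
  have hI : Set.Icc 0 t ⊆ Set.Ico 0 T := fun s hs => ⟨hs.1, hs.2.trans_lt ht.2⟩
  have h0 : (0:ℂ) ∈ Metric.ball (0:ℂ) 1 := by simp
  have hd : ∀ s ∈ Set.Icc 0 t, HasDerivWithinAt (fun s => f 0 s) 0 (Set.Icc 0 t) s :=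
    fun s hs => by simpa using (hf_pde 0 h0 s (hI hs)).mono hI
  have := constant_of_has_deriv_right_zero (fun s hs => (hd s hs).continuousWithinAt)
    (fun s hs => (hd s ⟨hs.1, hs.2.le⟩).mono_of_mem_nhdsWithin (Icc_mem_nhdsGE_of_mem hs)) t
    ⟨ht.1, le_rfl⟩
  exact this.trans (hf_init 0 h0)

theorem exists_backward_flow {P : ℂ → ℝ → ℂ} {M M' t : ℝ} (ht : 0 < t) (hM't : M' * t ≤ 1 / 2)
    (hM' : 0 ≤ M') (hbdd : ∀ s ∈ Set.Icc 0 t, ∀ z, ‖P z s‖ ≤ M)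
    (hlip : ∀ s ∈ Set.Icc 0 t, ∀ x y, ‖P x s - P y s‖ ≤ M' * ‖x - y‖)
    (hcont : ∀ z, ContinuousOn (P z) (Set.Icc 0 t))
    (hre : ∀ s ∈ Set.Icc 0 t, ∀ z, 0 ≤ (P z s).re) :
    ∃ Z : ℂ → ℝ → ℂ, (∀ z, Z z t = z) ∧
      (∀ z, ∀ s ∈ Set.Icc 0 t, HasDerivWithinAt (Z z) (P (Z z s) s) (Set.Icc 0 t) s) ∧
      (∀ z, ∀ s ∈ Set.Icc 0 t, (Z z s).re ≤ z.re) ∧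
      (∀ z, ‖Z z 0 - z‖ ≤ M * t) ∧
      (∀ x y, ‖(Z x 0 - x) - (Z y 0 - y)‖ ≤ 2 * M' * t * ‖x - y‖) ∧
      ∀ z η, (∀ s ∈ Set.Icc 0 t, ‖P z s - P z 0‖ ≤ η) →
        ‖Z z 0 - z + t * P z 0‖ ≤ t * (M' * M * t + η) := by
  have h0 : (0:ℝ) ∈ Set.Icc 0 t := ⟨le_rfl, ht.le⟩
  have h1 : t ∈ Set.Icc 0 t := ⟨ht.le, le_rfl⟩
  have hM : 0 ≤ M := (norm_nonneg _).trans (hbdd 0 h0 0)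
  have hex : ∀ z, ∃ α : ℝ → ℂ, α t = z ∧
      ∀ s ∈ Set.Icc 0 t, HasDerivWithinAt α (P (α s) s) (Set.Icc 0 t) s := by
    intro z
    have hPL : IsPicardLindelof (fun s x => P x s) (⟨t, h1⟩ : Set.Icc 0 t) z
        (⟨M * t, by positivity⟩ : NNReal) 0 ⟨M, hM⟩ ⟨M', hM'⟩ :=
      { lipschitzOnWith := fun s hs => LipschitzOnWith.of_dist_le_mul fun x _ y _ => by
          rw [dist_eq_norm, dist_eq_norm]; exact hlip s hs x y
        continuousOn := fun x _ => hcont x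
        norm_le := fun s hs x _ => hbdd s hs x
        mul_max_le := by simp [ht.le]; exact le_rfl }
    exact hPL.exists_eq_forall_mem_Icc_hasDerivWithinAt₀
  choose Z hZt hZ using hex
  have hdist : ∀ z, ∀ s ∈ Set.Icc 0 t, ‖Z z s - z‖ ≤ M * t := by
    intro z s hs
    have := (convex_Icc 0 t).norm_image_sub_le_of_norm_hasDerivWithin_le (hZ z)
      (fun u hu => hbdd u hu _) h1 hs
    rw [hZt, Real.norm_eq_abs, abs_sub_comm, abs_of_nonneg (sub_nonneg.2 hs.2)] at this
    exact this.trans (mul_le_mul_of_nonneg_left (by linarith [hs.1]) hM)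
  refine ⟨Z, hZt, hZ, ?_, fun z => hdist z 0 h0, ?_, ?_⟩
  · intro z s hs
    have hd : ∀ u ∈ Set.Icc 0 t,
        HasDerivWithinAt (fun u => (Z z u).re) (P (Z z u) u).re (Set.Icc 0 t) u := fun u hu =>
      Complex.reCLM.hasFDerivAt.comp_hasDerivWithinAt u (hZ z u hu)
    have hmono : MonotoneOn (fun u => (Z z u).re) (Set.Icc 0 t) := by
      refine monotoneOn_of_hasDerivWithinAt_nonneg (convex_Icc 0 t)
        (fun u hu => (hd u hu).continuousWithinAt)
        (fun u hu => (hd u (interior_subset hu)).mono interior_subset)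
        fun u hu => hre u (interior_subset hu) _
    have := hmono hs h1 hs.2
    simpa [hZt] using this
  · intro x y
    have hd : ∀ s ∈ Set.Icc 0 t, HasDerivWithinAt (fun s => (Z x s - x) - (Z y s - y))
        (P (Z x s) s - P (Z y s) s) (Set.Icc 0 t) s := fun s hs =>
      ((hZ x s hs).sub_const x).sub ((hZ y s hs).sub_const y)
    obtain ⟨m, hm, hmax⟩ := isCompact_Icc.exists_isMaxOn ⟨0, h0⟩
      (ContinuousOn.norm fun s hs => (hd s hs).continuousWithinAt)
    have hmax' : ∀ s ∈ Set.Icc 0 t, ‖(Z x s - x) - (Z y s - y)‖ ≤ ‖(Z x m - x) - (Z y m - y)‖ :=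
      fun s hs => hmax hs
    have hb := (convex_Icc 0 t).norm_image_sub_le_of_norm_hasDerivWithin_le hd
      (C := M' * (‖(Z x m - x) - (Z y m - y)‖ + ‖x - y‖)) (fun s hs => by
        refine (hlip s hs _ _).trans (mul_le_mul_of_nonneg_left ?_ hM')
        rw [show Z x s - Z y s = ((Z x s - x) - (Z y s - y)) + (x - y) by ring]
        exact (norm_add_le _ _).trans (by linarith [hmax' s hs])) h1 hm
    simp only [hZt, sub_self, sub_zero] at hb
    rw [Real.norm_eq_abs, abs_sub_comm, abs_of_nonneg (sub_nonneg.2 hm.2)] at hb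
    have h2 : M' * (‖(Z x m - x) - (Z y m - y)‖ + ‖x - y‖) * (t - m) ≤
        M' * (‖(Z x m - x) - (Z y m - y)‖ + ‖x - y‖) * t :=
      mul_le_mul_of_nonneg_left (by linarith [hm.1]) (by positivity)
    have h3 : M' * t * ‖(Z x m - x) - (Z y m - y)‖ ≤ 1 / 2 * ‖(Z x m - x) - (Z y m - y)‖ := by
      gcongr
    exact (hmax' 0 h0).trans (by linarith)
  · intro z η hη
    have hd : ∀ s ∈ Set.Icc 0 t, HasDerivWithinAt (fun s : ℝ => Z z s - s * P z 0)
        (P (Z z s) s - P z 0) (Set.Icc 0 t) s := fun s hs =>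
      (hZ z s hs).sub (by
        simpa using ((Complex.ofRealCLM.hasDerivAt (x := s)).mul_const (P z 0)).hasDerivWithinAt)
    have := (convex_Icc 0 t).norm_image_sub_le_of_norm_hasDerivWithin_le hd
      (C := M' * M * t + η) (fun s hs => by
        rw [show P (Z z s) s - P z 0 = (P (Z z s) s - P z s) + (P z s - P z 0) by ring]
        refine (norm_add_le _ _).trans (add_le_add ((hlip s hs _ _).trans ?_) (hη s hs))
        rw [mul_assoc]
        exact mul_le_mul_of_nonneg_left (hdist z s hs) hM') h1 h0
    rw [hZt] at this
    convert this using 1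
    · congr 1; push_cast; ring
    · rw [zero_sub, norm_neg, Real.norm_of_nonneg ht.le, mul_comm]

theorem norm_exp_min_re_sub_le (x y : ℂ) :
    ‖Complex.exp ⟨min x.re 0, x.im⟩ - Complex.exp ⟨min y.re 0, y.im⟩‖ ≤ ‖x - y‖ := by
  have h1 := (convex_halfSpace_re_le 0).norm_image_sub_le_of_norm_hasDerivWithin_le
    (f := Complex.exp) (C := 1) (x := ⟨min y.re 0, y.im⟩) (y := ⟨min x.re 0, x.im⟩)
    (fun z _ => (Complex.hasDerivAt_exp z).hasDerivWithinAt)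
    (fun z hz => by rw [Complex.norm_exp]; exact Real.exp_le_one_iff.2 hz)
    (show min y.re 0 ≤ 0 from min_le_right _ _) (show min x.re 0 ≤ 0 from min_le_right _ _)
  rw [one_mul] at h1
  refine h1.trans ?_
  have h2 : |min x.re 0 - min y.re 0| ≤ |x.re - y.re| := by
    simpa using abs_min_sub_min_le_max x.re 0 y.re 0
  rw [Complex.norm_def, Complex.norm_def]
  refine Real.sqrt_le_sqrt ?_
  simp only [Complex.normSq_apply, Complex.sub_re, Complex.sub_im]
  have := sq_le_sq.2 h2
  linarith

/-- The logarithm of the boundary values of a Löwner–Kufarev evolution for small times. -/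
theorem exists_boundary_log {T t M M' : ℝ} {p f fz : ℂ → ℝ → ℂ} (ht : 0 < t) (htT : t < T)
    (hM't : M' * t ≤ 1 / 2) (hM' : 0 ≤ M') (hMt : M * t < Real.pi)
    (hp_lip : ∀ t ∈ Set.Ico (0:ℝ) T, ∀ x ∈ Metric.closedBall (0:ℂ) 1,
      ∀ y ∈ Metric.closedBall (0:ℂ) 1, ‖p x t - p y t‖ ≤ M' * ‖x - y‖)
    (hp_re : ∀ t ∈ Set.Ico (0:ℝ) T, ∀ z ∈ Metric.closedBall (0:ℂ) 1, 0 ≤ (p z t).re)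
    (hp_t : ∀ z ∈ Metric.closedBall (0:ℂ) 1, ContinuousOn (fun t => p z t) (Set.Ico 0 T))
    (hp_bdd : ∀ z ∈ Metric.closedBall (0:ℂ) 1, ∀ t ∈ Set.Ico (0:ℝ) T, ‖p z t‖ ≤ M)
    (hf_init : ∀ z ∈ Metric.ball (0:ℂ) 1, f z 0 = z)
    (hf_hol : ∀ t ∈ Set.Ico (0:ℝ) T,
      DifferentiableOn ℂ (fun z => f z t) (Metric.ball (0:ℂ) 1))
    (hf_inj : ∀ t ∈ Set.Ico (0:ℝ) T,
      Set.InjOn (fun z => f z t) (Metric.ball (0:ℂ) 1))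
    (hf_cl : ∀ t ∈ Set.Ico (0:ℝ) T,
      ContinuousOn (fun z => f z t) (Metric.closedBall (0:ℂ) 1))
    (hfz : ∀ t ∈ Set.Ico (0:ℝ) T, ∀ z ∈ Metric.ball (0:ℂ) 1,
      HasDerivAt (fun x => f x t) (fz z t) z)
    (hf_pde : ∀ z ∈ Metric.ball (0:ℂ) 1, ∀ t ∈ Set.Ico (0:ℝ) T,
      HasDerivWithinAt (fun u => f z u) (-(z * fz z t * p z t)) (Set.Ico 0 T) t) :
    ∃ B : ℝ → ℂ, (∀ x : ℝ, f (Complex.exp (Complex.I * x)) t = Complex.exp (Complex.I * x + B x)) ∧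
      (∀ x y, ‖B x - B y‖ ≤ 2 * M' * t * |x - y|) ∧ (∀ x, ‖B x‖ ≤ M * t) ∧
      Function.Periodic B (2 * Real.pi) ∧
      ∀ (x : ℝ) η, (∀ s ∈ Set.Icc 0 t, ‖p (Complex.exp (Complex.I * x)) s -
          p (Complex.exp (Complex.I * x)) 0‖ ≤ η) →
        ‖B x + t * p (Complex.exp (Complex.I * x)) 0‖ ≤ t * (M' * M * t + η) := by
  have hI : Set.Icc 0 t ⊆ Set.Ico 0 T := fun s hs => ⟨hs.1, hs.2.trans_lt htT⟩
  have hE : ∀ z : ℂ, Complex.exp ⟨min z.re 0, z.im⟩ ∈ Metric.closedBall (0:ℂ) 1 := fun z => by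
    rw [mem_closedBall_zero_iff, Complex.norm_exp]
    exact Real.exp_le_one_iff.2 (min_le_right _ _)
  have hEeq : ∀ z : ℂ, z.re ≤ 0 → Complex.exp ⟨min z.re 0, z.im⟩ = Complex.exp z := fun z hz => by
    rw [min_eq_left hz]
  obtain ⟨Z, hZt, hZ, hZre, hZb, hZlip, hZapprox⟩ := exists_backward_flow
    (P := fun z s => p (Complex.exp ⟨min z.re 0, z.im⟩) s) ht hM't hM'
    (fun s hs z => hp_bdd _ (hE z) s (hI hs))
    (fun s hs x y => (hp_lip s (hI hs) _ (hE x) _ (hE y)).trans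
      (mul_le_mul_of_nonneg_left (norm_exp_min_re_sub_le x y) hM'))
    (fun z => (hp_t _ (hE z)).mono hI) (fun s hs z => hp_re s (hI hs) _ (hE z))
  have hinner : ∀ z : ℂ, z.re < 0 → f (Complex.exp z) t = Complex.exp (Z z 0) := by
    intro z hz
    have := eq_of_characteristic (r := Real.exp z.re) (w := fun s => Complex.exp (Z z s)) htT
      (Real.exp_lt_one_iff.2 hz) hf_init hf_hol hf_inj hfz hf_pde
      (fun s hs => loewner_kufarev_map_zero hf_init hf_pde hs)
      (fun s hs => by rw [Complex.norm_exp]; exact Real.exp_le_exp.2 (hZre z s hs))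
      (fun s hs => by
        have h1 := (hZ z s hs).cexp
        rwa [hEeq _ ((hZre z s hs).trans hz.le)] at h1) ht.le
    simpa only [hZt] using this
  have hZc : Continuous fun z => Z z 0 := by
    have h1 : Continuous fun z => Z z 0 - z := by
      refine LipschitzWith.continuous (K := Real.toNNReal (2 * M' * t))
        (LipschitzWith.of_dist_le_mul fun x y => ?_)
      rw [dist_eq_norm, dist_eq_norm, Real.coe_toNNReal _ (by positivity)]
      exact hZlip x y
    exact (h1.add continuous_id).congr fun z => sub_add_cancel _ _
  have hbdry : ∀ z : ℂ, z.re ≤ 0 → f (Complex.exp z) t = Complex.exp (Z z 0) := by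
    intro z hz
    have hpath : Tendsto (fun u : ℝ => z + u) (𝓝[<] 0) (𝓝 z) := by
      have : Continuous fun u : ℝ => z + u := by fun_prop
      simpa using (this.tendsto 0).mono_left nhdsWithin_le_nhds
    have hneg : ∀ᶠ u : ℝ in 𝓝[<] 0, (z + u).re < 0 := by
      filter_upwards [self_mem_nhdsWithin] with u hu
      have : u < 0 := hu
      simp only [Complex.add_re, Complex.ofReal_re]
      linarith
    refine tendsto_nhds_unique_of_eventuallyEq (l := 𝓝[<] (0:ℝ))
      (f := fun u : ℝ => f (Complex.exp (z + u)) t) (g := fun u : ℝ => Complex.exp (Z (z + u) 0))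
      ?_ ?_ (hneg.mono fun u hu => hinner _ hu)
    · refine (hf_cl t ⟨ht.le, htT⟩ (Complex.exp z) ?_).tendsto.comp
        (tendsto_nhdsWithin_iff.2 ⟨(Complex.continuous_exp.tendsto z).comp hpath, ?_⟩)
      · rw [mem_closedBall_zero_iff, Complex.norm_exp]
        exact Real.exp_le_one_iff.2 hz
      · filter_upwards [hneg] with u hu
        rw [mem_closedBall_zero_iff, Complex.norm_exp]
        exact Real.exp_le_one_iff.2 hu.le
    · exact ((Complex.continuous_exp.comp hZc).tendsto z).comp hpath
  have hre : ∀ x : ℝ, (Complex.I * x).re ≤ 0 := fun x => by simp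
  have hf : ∀ x : ℝ, f (Complex.exp (Complex.I * x)) t =
      Complex.exp (Complex.I * x + (Z (Complex.I * x) 0 - Complex.I * x)) := fun x => by
    rw [hbdry _ (hre x), add_sub_cancel]
  refine ⟨fun x => Z (Complex.I * x) 0 - Complex.I * x, hf, fun x y => ?_, fun x => hZb _, ?_, ?_⟩
  · refine (hZlip _ _).trans (le_of_eq ?_)
    rw [← mul_sub, norm_mul, Complex.norm_I, one_mul, ← Complex.ofReal_sub, Complex.norm_real,
      Real.norm_eq_abs]
  · intro x
    have him : ∀ x : ℝ, |(Z (Complex.I * x) 0 - Complex.I * x).im| < Real.pi := fun x =>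
      (Complex.abs_im_le_norm _).trans_lt ((hZb _).trans_lt hMt)
    have hexp : Complex.exp (Complex.I * (x + 2 * Real.pi : ℝ)) = Complex.exp (Complex.I * x) := by
      push_cast
      rw [mul_add, show Complex.I * (2 * Real.pi) = 2 * Real.pi * Complex.I by ring,
        Complex.exp_periodic]
    have h1 := hf x
    have h2 := hf (x + 2 * Real.pi)
    rw [Complex.exp_add] at h1 h2
    rw [hexp, h1] at h2
    have h3 := mul_left_cancel₀ (Complex.exp_ne_zero _) h2
    have ha := abs_lt.1 (him x)
    have hb := abs_lt.1 (him (x + 2 * Real.pi))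
    exact (Complex.exp_inj_of_neg_pi_lt_of_le_pi ha.1 ha.2.le hb.1 hb.2.le h3).symm
  · intro x η hη
    have := hZapprox (Complex.I * x) η
    simp only [hEeq _ (hre x)] at this
    exact this hη

theorem norm_sub_le_of_hasDerivAt_ball {g g' : ℂ → ℂ} {M : ℝ} (hM : 0 ≤ M)
    (hg : ContinuousOn g (Metric.closedBall 0 1))
    (hg' : ∀ z ∈ Metric.ball (0:ℂ) 1, HasDerivAt g (g' z) z)
    (hbd : ∀ z ∈ Metric.ball (0:ℂ) 1, ‖g' z‖ ≤ M) :
    ∀ x ∈ Metric.closedBall (0:ℂ) 1, ∀ y ∈ Metric.closedBall (0:ℂ) 1,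
      ‖g x - g y‖ ≤ M * ‖x - y‖ := by
  intro x hx y hy
  have hball : LipschitzOnWith ⟨M, hM⟩ g (Metric.ball 0 1) :=
    LipschitzOnWith.of_dist_le_mul fun x hx y hy => by
      rw [dist_eq_norm, dist_eq_norm]
      exact (convex_ball (0:ℂ) 1).norm_image_sub_le_of_norm_hasDerivWithin_le
        (fun z hz => (hg' z hz).hasDerivWithinAt) hbd hy hx
  rw [← closure_ball (0:ℂ) one_ne_zero] at hg hx hy
  have := ((lipschitzOnWith_closure_iff hg).2 hball).dist_le_mul x hx y hy
  rwa [dist_eq_norm, dist_eq_norm] at this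

theorem eventually_forall_norm_sub_le {T M δ : ℝ} (hT : 0 < T) (hM : 0 ≤ M) (hδ : 0 < δ)
    {p : ℂ → ℝ → ℂ}
    (hp_t : ∀ z ∈ Metric.closedBall (0:ℂ) 1, ContinuousOn (fun t => p z t) (Set.Ico 0 T))
    (hp_lip : ∀ t ∈ Set.Ico (0:ℝ) T, ∀ x ∈ Metric.closedBall (0:ℂ) 1,
      ∀ y ∈ Metric.closedBall (0:ℂ) 1, ‖p x t - p y t‖ ≤ M * ‖x - y‖) :
    ∀ᶠ t in 𝓝[>] (0:ℝ), ∀ s ∈ Set.Icc 0 t, ∀ z ∈ Metric.closedBall (0:ℂ) 1,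
      ‖p z s - p z 0‖ ≤ δ := by
  have h0 : (0:ℝ) ∈ Set.Ico 0 T := ⟨le_rfl, hT⟩
  obtain ⟨e, he⟩ : ∃ e, e = δ / (3 * (M + 1)) := ⟨_, rfl⟩
  have he0 : 0 < e := by rw [he]; positivity
  have hMe : M * e ≤ δ / 3 := by
    have : e * (3 * (M + 1)) = δ := by rw [he]; field_simp
    linarith
  obtain ⟨I, hI, hIfin, hcover⟩ := (isCompact_closedBall (0:ℂ) 1).finite_cover_balls he0
  have hev : ∀ᶠ s in 𝓝[Set.Ico 0 T] (0:ℝ), ∀ z ∈ I, dist (p z s) (p z 0) < δ / 3 :=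
    hIfin.eventually_all.2 fun z hz =>
      Metric.tendsto_nhds.1 (hp_t z (hI hz) 0 h0) _ (by positivity)
  obtain ⟨r, hr, hsub⟩ := Metric.mem_nhdsWithin_iff.1 hev
  filter_upwards [Ioo_mem_nhdsGT (lt_min hr hT)] with t ht s hs z hz
  have hsT : s ∈ Set.Ico 0 T := ⟨hs.1, hs.2.trans_lt (ht.2.trans_le (min_le_right _ _))⟩
  have hsr : s ∈ Metric.ball (0:ℝ) r := by
    rw [mem_ball_zero_iff, Real.norm_of_nonneg hs.1]
    exact hs.2.trans_lt (ht.2.trans_le (min_le_left _ _))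
  obtain ⟨w, hw, hzw⟩ := Set.mem_iUnion₂.1 (hcover hz)
  have h1 : dist (p w s) (p w 0) < δ / 3 := hsub ⟨hsr, hsT⟩ w hw
  rw [mem_ball_iff_norm] at hzw
  have h2 := hp_lip s hsT z hz w (hI hw)
  have h3 := hp_lip 0 h0 z hz w (hI hw)
  have h4 : M * ‖z - w‖ ≤ M * e := by gcongr
  rw [← dist_eq_norm] at h2 h3 ⊢
  have h5 := dist_triangle4 (p z s) (p w s) (p w 0) (p z 0)
  rw [dist_comm (p w 0) (p z 0)] at h5
  linarith

theorem eventually_mul_lt_nhdsGT {D e : ℝ} (he : 0 < e) : ∀ᶠ t in 𝓝[>] (0:ℝ), D * t < e := by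
  have h : Tendsto (fun t : ℝ => D * t) (𝓝[>] 0) (𝓝 0) := by
    have : Continuous fun t : ℝ => D * t := by fun_prop
    simpa using (this.tendsto 0).mono_left nhdsWithin_le_nhds
  exact h.eventually_lt_const he

theorem exists_mul_sqrt_le {A c : ℝ} (hA : 0 ≤ A) (hc : 0 < c) :
    ∃ s, 0 < s ∧ s ≤ 1 ∧ A * √s ≤ c := by
  refine ⟨min 1 (c / (A + 1)) ^ 2, by positivity, pow_le_one₀ (by positivity) (min_le_left _ _), ?_⟩
  rw [Real.sqrt_sq (by positivity)]
  have h1 : min 1 (c / (A + 1)) ≤ c / (A + 1) := min_le_right _ _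
  rw [le_div_iff₀ (by positivity)] at h1
  have h2 : 0 ≤ min 1 (c / (A + 1)) := by positivity
  linarith

/- STATEMENT 16 (Theorem 1): Asymptotic conformal welding via the
Löwner–Kufarev evolution.  For the interior maps f(·,t) (solving the
Löwner–Kufarev PDE with Carathéodory driving function p, C² on 𝔻̄ and bounded
together with p', p''), the exterior maps F(·,τ(t)) of 𝔻* onto the unbounded
complementary component of Γ(t) = f(𝕋,t) with expansion e^{-τ}z + b₀ + …
at ∞ and exterior Löwner–Kufarev equation driven by q, the conformal welding
φ_t (defined by f(e^{iφ_t(θ)},t) = F(e^{iθ},τ(t)), φ_t(θ) → θ as t → 0+)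
satisfies φ_t(θ) = θ + 2·Im p(e^{iθ},0)·t + o(t) as t → 0+. -/
theorem loewner_kufarev_asymptotic_conformal_welding
    (T : ℝ) (hT : 0 < T) (p p' p'' : ℂ → ℝ → ℂ)
    -- Carathéodory class driving function, C² on 𝔻̄, continuous in t,
    -- with p, p', p'' bounded on 𝔻̄ × [0,T)
    (hp_hol : ∀ t ∈ Set.Ico (0:ℝ) T,
      DifferentiableOn ℂ (fun z => p z t) (Metric.ball (0:ℂ) 1))
    (hp_cont : ∀ t ∈ Set.Ico (0:ℝ) T,
      ContinuousOn (fun z => p z t) (Metric.closedBall (0:ℂ) 1))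
    (hp_one : ∀ t ∈ Set.Ico (0:ℝ) T, p 0 t = 1)
    (hp_re : ∀ t ∈ Set.Ico (0:ℝ) T, ∀ z ∈ Metric.ball (0:ℂ) 1, 0 < (p z t).re)
    (hp' : ∀ t ∈ Set.Ico (0:ℝ) T, ∀ z ∈ Metric.ball (0:ℂ) 1,
      HasDerivAt (fun x => p x t) (p' z t) z)
    (hp'' : ∀ t ∈ Set.Ico (0:ℝ) T, ∀ z ∈ Metric.ball (0:ℂ) 1,
      HasDerivAt (fun x => p' x t) (p'' z t) z)
    (hp'_cont : ∀ t ∈ Set.Ico (0:ℝ) T,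
      ContinuousOn (fun z => p' z t) (Metric.closedBall (0:ℂ) 1))
    (hp''_cont : ∀ t ∈ Set.Ico (0:ℝ) T,
      ContinuousOn (fun z => p'' z t) (Metric.closedBall (0:ℂ) 1))
    (hp_t : ∀ z ∈ Metric.closedBall (0:ℂ) 1, ContinuousOn (fun t => p z t) (Set.Ico 0 T))
    (M M' M'' : ℝ)
    (hp_bdd : ∀ z ∈ Metric.closedBall (0:ℂ) 1, ∀ t ∈ Set.Ico (0:ℝ) T, ‖p z t‖ ≤ M)
    (hp'_bdd : ∀ z ∈ Metric.closedBall (0:ℂ) 1, ∀ t ∈ Set.Ico (0:ℝ) T, ‖p' z t‖ ≤ M')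
    (hp''_bdd : ∀ z ∈ Metric.closedBall (0:ℂ) 1, ∀ t ∈ Set.Ico (0:ℝ) T, ‖p'' z t‖ ≤ M'')
    -- interior maps: f solves the Löwner–Kufarev PDE, f(z,0) = z, each f(·,t)
    -- univalent on 𝔻 and continuous on 𝔻̄
    (f fz : ℂ → ℝ → ℂ)
    (hf_init : ∀ z ∈ Metric.ball (0:ℂ) 1, f z 0 = z)
    (hf_hol : ∀ t ∈ Set.Ico (0:ℝ) T,
      DifferentiableOn ℂ (fun z => f z t) (Metric.ball (0:ℂ) 1))
    (hf_inj : ∀ t ∈ Set.Ico (0:ℝ) T,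
      Set.InjOn (fun z => f z t) (Metric.ball (0:ℂ) 1))
    (hf_cl : ∀ t ∈ Set.Ico (0:ℝ) T,
      ContinuousOn (fun z => f z t) (Metric.closedBall (0:ℂ) 1))
    (hfz : ∀ t ∈ Set.Ico (0:ℝ) T, ∀ z ∈ Metric.ball (0:ℂ) 1,
      HasDerivAt (fun x => f x t) (fz z t) z)
    (hf_pde : ∀ z ∈ Metric.ball (0:ℂ) 1, ∀ t ∈ Set.Ico (0:ℝ) T,
      HasDerivWithinAt (fun u => f z u) (-(z * fz z t * p z t)) (Set.Ico 0 T) t)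
    -- Ω*(t): the unbounded connected component of the complement of
    -- Γ(t) = f(𝕋,t)
    (Ωstar : ℝ → Set ℂ)
    (hΩstar : ∀ t ∈ Set.Ico (0:ℝ) T, ∃ x : ℂ,
      ¬ Bornology.IsBounded
        (connectedComponentIn ((fun z => f z t) '' Metric.sphere (0:ℂ) 1)ᶜ x) ∧
      Ωstar t = connectedComponentIn ((fun z => f z t) '' Metric.sphere (0:ℂ) 1)ᶜ x)
    -- the time change τ, differentiable with τ(0) = 0 and τ' > 0
    (τ τd : ℝ → ℝ)
    (hτ_init : τ 0 = 0)
    (hτd : ∀ t ∈ Set.Ico (0:ℝ) T, HasDerivWithinAt τ (τd t) (Set.Ico 0 T) t)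
    (hτd_pos : ∀ t ∈ Set.Ico (0:ℝ) T, 0 < τd t)
    -- exterior maps: F(·,τ(t)) maps 𝔻* = {|z| > 1} injectively and
    -- holomorphically onto Ω*(t), extends continuously to 𝕋 with
    -- F(𝕋,τ(t)) = f(𝕋,t), and F(z,τ) = e^{-τ}z + b₀(τ) + O(1/z) at ∞
    (F Fz : ℂ → ℝ → ℂ) (b₀ : ℝ → ℂ)
    (hF_hol : ∀ t ∈ Set.Ico (0:ℝ) T,
      DifferentiableOn ℂ (fun z => F z (τ t)) {z : ℂ | 1 < ‖z‖})
    (hF_inj : ∀ t ∈ Set.Ico (0:ℝ) T,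
      Set.InjOn (fun z => F z (τ t)) {z : ℂ | 1 < ‖z‖})
    (hF_onto : ∀ t ∈ Set.Ico (0:ℝ) T,
      (fun z => F z (τ t)) '' {z : ℂ | 1 < ‖z‖} = Ωstar t)
    (hF_cl : ∀ t ∈ Set.Ico (0:ℝ) T,
      ContinuousOn (fun z => F z (τ t)) {z : ℂ | 1 ≤ ‖z‖})
    (hF_exp : ∀ t ∈ Set.Ico (0:ℝ) T,
      Tendsto (fun z : ℂ => F z (τ t) - Complex.exp (-(τ t : ℂ)) * z)
        (Bornology.cobounded ℂ) (𝓝 (b₀ (τ t))))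
    (hF_weld_set : ∀ t ∈ Set.Ico (0:ℝ) T,
      (fun z => F z (τ t)) '' Metric.sphere (0:ℂ) 1 =
        (fun z => f z t) '' Metric.sphere (0:ℂ) 1)
    (hFz : ∀ t ∈ Set.Ico (0:ℝ) T, ∀ z ∈ {z : ℂ | 1 < ‖z‖},
      HasDerivAt (fun x => F x (τ t)) (Fz z (τ t)) z)
    -- exterior Löwner–Kufarev equation with driving function q, holomorphic on
    -- 𝔻*, q(z,t) → 1 as z → ∞, Re q > 0 on 𝔻*
    (q : ℂ → ℝ → ℂ)
    (hq_hol : ∀ t ∈ Set.Ico (0:ℝ) T,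
      DifferentiableOn ℂ (fun z => q z t) {z : ℂ | 1 < ‖z‖})
    (hq_lim : ∀ t ∈ Set.Ico (0:ℝ) T,
      Tendsto (fun z => q z t) (Bornology.cobounded ℂ) (𝓝 1))
    (hq_re : ∀ t ∈ Set.Ico (0:ℝ) T, ∀ z ∈ {z : ℂ | 1 < ‖z‖}, 0 < (q z t).re)
    (hF_pde : ∀ z ∈ {z : ℂ | 1 < ‖z‖}, ∀ t ∈ Set.Ico (0:ℝ) T,
      HasDerivWithinAt (fun u => F z (τ u))
        (-(z * Fz z (τ t) * q z t * τd t)) (Set.Ico 0 T) t)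
    -- the conformal welding φ_t of Γ(t): f(e^{iφ_t(θ)},t) = F(e^{iθ},τ(t)),
    -- continuous in θ with φ_t(θ) → θ as t → 0+
    (Φ : ℝ → ℝ → ℝ)
    (hΦ_cont : ∀ t ∈ Set.Ioo (0:ℝ) T, Continuous (Φ t))
    (hΦ_lim : ∀ θ : ℝ, Tendsto (fun t => Φ t θ) (𝓝[>] (0:ℝ)) (𝓝 θ))
    (hΦ_weld : ∀ t ∈ Set.Ioo (0:ℝ) T, ∀ θ : ℝ,
      f (Complex.exp (Complex.I * ((Φ t θ : ℝ) : ℂ))) t =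
        F (Complex.exp (Complex.I * (θ:ℂ))) (τ t)) :
    ∀ θ : ℝ,
      (fun t : ℝ => Φ t θ - θ -
          2 * (p (Complex.exp (Complex.I * (θ:ℂ))) 0).im * t)
        =o[𝓝[>] (0:ℝ)] (fun t : ℝ => t) := by
  intro θ
  have hT0 : (0:ℝ) ∈ Set.Ico 0 T := ⟨le_rfl, hT⟩
  have h0c : (0:ℂ) ∈ Metric.closedBall (0:ℂ) 1 := by simp
  have hM : 0 ≤ M := (norm_nonneg _).trans (hp_bdd 0 h0c 0 hT0)
  have hM' : 0 ≤ M' := (norm_nonneg _).trans (hp'_bdd 0 h0c 0 hT0)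
  have hp_lip : ∀ t ∈ Set.Ico (0:ℝ) T, ∀ x ∈ Metric.closedBall (0:ℂ) 1,
      ∀ y ∈ Metric.closedBall (0:ℂ) 1, ‖p x t - p y t‖ ≤ M' * ‖x - y‖ := fun t ht =>
    norm_sub_le_of_hasDerivAt_ball hM' (hp_cont t ht) (hp' t ht)
      fun z hz => hp'_bdd z (Metric.ball_subset_closedBall hz) t ht
  have hp_re' : ∀ t ∈ Set.Ico (0:ℝ) T, ∀ z ∈ Metric.closedBall (0:ℂ) 1, 0 ≤ (p z t).re := by
    intro t ht z hz
    have hc := hp_cont t ht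
    rw [← closure_ball (0:ℂ) one_ne_zero] at hz hc
    exact le_on_closure (f := fun _ => (0:ℝ)) (g := fun z => (p z t).re)
      (fun z hz => (hp_re t ht z hz).le) continuousOn_const
      (Complex.continuous_re.comp_continuousOn hc) hz
  have hcirc : ∀ x : ℝ, Complex.exp (Complex.I * x) ∈ Metric.closedBall (0:ℂ) 1 := fun x => by
    simp
  rw [isLittleO_iff]
  intro c hc
  obtain ⟨C, hC⟩ : ∃ C, C = 2 * M' + M := ⟨_, rfl⟩
  have hC0 : 0 ≤ C := by rw [hC]; positivity
  obtain ⟨s, hs0, hs1, hsc⟩ := exists_mul_sqrt_le (A := 4 * (12 * C + 8 * M')) (c := c / 2)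
    (by positivity) (by positivity)
  have hsq : 0 < √s := Real.sqrt_pos.2 hs0
  filter_upwards [Ioo_mem_nhdsGT hT, eventually_mul_lt_nhdsGT (D := C) (e := 1 / 4) (by norm_num),
    eventually_mul_lt_nhdsGT (D := M) Real.pi_pos,
    eventually_mul_lt_nhdsGT (D := 6 * (M' * M + 2 * M' * C)) (e := c * √s / 4) (by positivity),
    eventually_forall_norm_sub_le hT hM' (δ := c * √s / 24) (by positivity) hp_t hp_lip,
    Metric.tendsto_nhds.1 (hΦ_lim θ) Real.pi Real.pi_pos,
    eventually_mul_lt_nhdsGT (D := 2 * |(p (Complex.exp (Complex.I * θ)) 0).im| + c) Real.pi_pos]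
    with t ht hCt hMt hDt hη hΦθ hmt
  have htI : t ∈ Set.Ico 0 T := ⟨ht.1.le, ht.2⟩
  have hM't : M' * t ≤ 1 / 2 := by
    rw [hC] at hCt
    nlinarith [mul_nonneg hM ht.1.le, mul_nonneg hM' ht.1.le]
  obtain ⟨B, hfB, hBlip, hBbd, hBper, hBp⟩ := exists_boundary_log ht.1 ht.2 hM't hM' hMt hp_lip
    hp_re' hp_t hp_bdd hf_init hf_hol hf_inj hf_cl hfz hf_pde
  have hBlip' : ∀ x y, ‖B x - B y‖ ≤ C * t * |x - y| := fun x y =>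
    (hBlip x y).trans (by have := ht.1.le; gcongr; linarith)
  have hf0 := loewner_kufarev_map_zero hf_init hf_pde htI
  have hne : ∀ z : ℂ, 1 ≤ ‖z‖ → F z (τ t) ≠ 0 := by
    intro z hz hFz0
    rcases hz.lt_or_eq with hz | hz
    · obtain ⟨x, hx, hΩ⟩ := hΩstar t htI
      have hmem : F z (τ t) ∈ Ωstar t := hF_onto t htI ▸ Set.mem_image_of_mem _ hz
      rw [hFz0, hΩ] at hmem
      exact zero_notMem_of_unbounded_component (hf_hol t htI) (hf_inj t htI) (hf_cl t htI) hf0 hx hmem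
    · have hmem : F z (τ t) ∈ (fun z => f z t) '' Metric.sphere (0:ℂ) 1 :=
        hF_weld_set t htI ▸ Set.mem_image_of_mem _ (by simpa using hz.symm)
      obtain ⟨w, hw, hwz⟩ := hmem
      have hwe : Complex.exp (Complex.I * w.arg) = w := by
        have := Complex.norm_mul_exp_arg_mul_I w
        rwa [mem_sphere_zero_iff_norm.1 hw, Complex.ofReal_one, one_mul, mul_comm] at this
      have := hfB w.arg
      rw [hwe, show f w t = 0 from hwz.trans hFz0] at this
      exact Complex.exp_ne_zero _ this.symm
  obtain ⟨L, hL, hL0, hLF⟩ := exists_exterior_log (F := fun z => F z (τ t)) (Real.exp_pos (-τ t))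
    (hF_hol t htI) (hF_cl t htI) (by simpa using hF_exp t htI) hne
  have hLc : Continuous fun x : ℝ => L (Complex.exp (Complex.I * x)) :=
    hL.continuousOn_ball.comp_continuous (by fun_prop) hcirc
  obtain ⟨k, hk, hper⟩ := exists_int_lift_of_exp_eq hLc
    (fun x y => (hBlip' x y).trans (by gcongr)) hBper (hΦ_cont t ht)
    fun x => by rw [← hfB, hΦ_weld t ht, hLF]
  have hP : DiffContOnCl ℂ (fun z => p z 0) (Metric.ball 0 1) :=
    ⟨hp_hol 0 hT0, by rw [closure_ball _ one_ne_zero]; exact hp_cont 0 hT0⟩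
  have hest := welding_estimate (P := fun z => p z 0) (B := B) (φ := fun x => Φ t x - k * (2 * Real.pi))
    (C := C) (δ := M' * M * t + c * √s / 24) (M := M') ht.1 hC0
    (by have := ht.1.le; positivity) hM' hCt.le hL hL0 hP (by simp [hp_one 0 hT0])
    (fun x y => (hp_lip 0 hT0 _ (hcirc x) _ (hcirc y)).trans (by
      gcongr
      rw [show Complex.exp (Complex.I * x) = Complex.exp (Complex.I * y) *
        Complex.exp (Complex.I * (x - y : ℝ)) by rw [← Complex.exp_add]; congr 1; push_cast; ring,
        ← mul_sub_one, norm_mul, mul_comm Complex.I, Complex.norm_exp_ofReal_mul_I, one_mul]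
      exact Real.norm_exp_I_mul_ofReal_sub_one_le))
    hBlip' (fun x => (hBbd x).trans (by have := ht.1.le; gcongr; linarith))
    (fun x => hBp x _ fun u hu => hη u hu _ (hcirc x)) ((hΦ_cont t ht).sub continuous_const)
    (fun x => by rw [hper]; ring) hk hs0 hs1 θ
  have hfin : |Φ t θ - k * (2 * Real.pi) - θ - 2 * (p (Complex.exp (Complex.I * θ)) 0).im * t| ≤
      c * t := by
    refine hest.trans ?_
    rw [mul_comm c t]
    refine mul_le_mul_of_nonneg_left ?_ ht.1.le
    have h1 : 6 * (M' * M * t + c * √s / 24 + 2 * M' * C * t) / √s ≤ c / 2 := by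
      rw [div_le_iff₀ hsq]
      linarith
    linarith
  have hk0 : k = 0 := by
    rw [Real.dist_eq] at hΦθ
    by_contra hk0
    have h1 : (1:ℝ) ≤ |(k:ℝ)| := by exact_mod_cast Int.one_le_abs hk0
    have h2 : |(k:ℝ) * (2 * Real.pi)| = |(k:ℝ)| * (2 * Real.pi) := by
      rw [abs_mul, abs_of_pos Real.two_pi_pos]
    have h3 : |2 * (p (Complex.exp (Complex.I * θ)) 0).im * t| =
        2 * |(p (Complex.exp (Complex.I * θ)) 0).im| * t := by
      rw [abs_mul, abs_mul, abs_of_pos ht.1, abs_two]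
    rw [abs_lt] at hΦθ
    rw [abs_le] at hfin
    have h4 := abs_le.1 h3.le
    have h5 : |(k:ℝ) * (2 * Real.pi)| < 2 * Real.pi := by
      rw [abs_lt]
      constructor <;> linarith [hΦθ.1, hΦθ.2, hfin.1, hfin.2, h4.1, h4.2]
    nlinarith [Real.pi_pos]
  rw [hk0, Int.cast_zero, zero_mul, sub_zero] at hfin
  rwa [Real.norm_eq_abs, Real.norm_of_nonneg ht.1.le]
end

section
/- In the welding setting of Theorem 1 (interior maps f(z,t) = e^{-t}z + … solving the Löwner–Kufarev PDE with driving function p, exterior maps F(z,τ) = e^{-τ}z + b₀(τ) + … of 𝔻* onto the unbounded complementary component of Γ(t), with F(𝕋,τ(t)) = f(𝕋,t) and τ differentiable at 0 with τ(0) = 0), the time change τ satisfies τ'(0) = 1; equivalently τ(t) = t + o(t) as t → 0+. -/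
open Filter Topology Asymptotics

open Metric in
/-- A family of holomorphic functions that is continuous in a parameter and uniformly bounded is
jointly continuous. -/
lemma continuousOn_uncurry_of_bounded {U : Set ℂ} (hU : IsOpen U) {K : Set ℝ} {f : ℂ → ℝ → ℂ}
    {C : ℝ} (hol : ∀ t ∈ K, DifferentiableOn ℂ (fun z => f z t) U)
    (hcont : ∀ z ∈ U, ContinuousOn (f z) K) (hC : ∀ z ∈ U, ∀ t ∈ K, ‖f z t‖ ≤ C) :
    ContinuousOn (Function.uncurry f) (U ×ˢ K) := by
  rintro ⟨z₀, t₀⟩ ⟨hz₀, ht₀⟩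
  obtain ⟨ε, hε, hεU⟩ := Metric.isOpen_iff.1 hU z₀ hz₀
  have hsub : ∀ x ∈ ball z₀ (ε / 2), closedBall x (ε / 3) ⊆ U := fun x hx y hy =>
    hεU (by
      rw [mem_ball] at hx ⊢
      rw [mem_closedBall] at hy
      linarith [dist_triangle y x z₀])
  have key : ContinuousOn (Function.uncurry f) (ball z₀ (ε / 2) ×ˢ K) := by
    refine continuousOn_prod_of_continuousOn_lipschitzOnWith _ (C / (ε / 3)).toNNReal
      (fun a ha => hcont a (hsub a ha (mem_closedBall_self (by positivity)))) fun t ht => ?_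
    refine Convex.lipschitzOnWith_of_nnnorm_deriv_le
      (fun x hx => (hol t ht).differentiableAt
        (hU.mem_nhds (hsub x hx (mem_closedBall_self (by positivity)))))
      (fun x hx => ?_) (convex_ball _ _)
    refine NNReal.le_toNNReal_of_coe_le ?_
    exact Complex.norm_deriv_le_of_forall_mem_sphere_norm_le (by positivity)
      ((hol t ht).diffContOnCl_ball (hsub x hx))
      fun z hz => hC z (hsub x hx (sphere_subset_closedBall hz)) t ht
  refine (key (z₀, t₀) ⟨mem_ball_self (by positivity), ht₀⟩).mono_of_mem_nhdsWithin ?_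
  have : ball z₀ (ε / 2) ×ˢ (Set.univ : Set ℝ) ∈ 𝓝 (z₀, t₀) :=
    prod_mem_nhds (ball_mem_nhds _ (by positivity)) univ_mem
  filter_upwards [mem_nhdsWithin_of_mem_nhds this, self_mem_nhdsWithin] with x hx hx'
  exact ⟨hx.1, hx'.2⟩

open Metric in
/-- Osgood's theorem: a pointwise bounded family of continuous functions is uniformly bounded on
some small ball. -/
lemma exists_ball_bounded {K : Set ℝ} {f : ℂ → ℝ → ℂ}
    (hf : ∀ t ∈ K, ContinuousOn (fun z => f z t) (ball 0 1))
    (hb : ∀ z ∈ ball (0 : ℂ) 1, ∃ C, ∀ t ∈ K, ‖f z t‖ ≤ C) :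
    ∃ z₀ ∈ ball (0 : ℂ) (1 / 2), ∃ ε > 0, ε ≤ 1 / 4 ∧ ∃ C : ℝ, ∀ z ∈ ball z₀ ε, ∀ t ∈ K,
      ‖f z t‖ ≤ C := by
  have hmem : ∀ z ∈ closedBall (0 : ℂ) (1 / 2), z ∈ ball (0 : ℂ) 1 := fun z hz =>
    closedBall_subset_ball (by norm_num) hz
  let A : ℕ → Set ℂ := fun n =>
    {z ∈ closedBall (0 : ℂ) (1 / 2) | ∀ t ∈ K, ‖f z t‖ ≤ n} ∪ (ball 0 (1 / 2))ᶜ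
  have hAc : ∀ n, IsClosed (A n) := by
    intro n
    refine IsClosed.union ?_ isOpen_ball.isClosed_compl
    have : {z ∈ closedBall (0 : ℂ) (1 / 2) | ∀ t ∈ K, ‖f z t‖ ≤ n} =
        closedBall (0 : ℂ) (1 / 2) ∩ ⋂ t ∈ K,
          {z ∈ closedBall (0 : ℂ) (1 / 2) | ‖f z t‖ ≤ n} := by
      ext z
      simp only [Set.mem_inter_iff, Set.mem_iInter, Set.mem_ofPred_eq]
      exact ⟨fun h => ⟨h.1, fun t ht => ⟨h.1, h.2 t ht⟩⟩, fun h => ⟨h.1, fun t ht => (h.2 t ht).2⟩⟩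
    rw [this]
    refine isClosed_closedBall.inter (isClosed_biInter fun t ht => ?_)
    have := (((hf t ht).mono hmem).norm).preimage_isClosed_of_isClosed
      isClosed_closedBall (isClosed_Iic (a := (n : ℝ)))
    exact this
  have hAu : ⋃ n, A n = Set.univ := by
    refine Set.eq_univ_of_forall fun z => Set.mem_iUnion.2 ?_
    by_cases hz : z ∈ ball (0 : ℂ) (1 / 2)
    · obtain ⟨C, hC⟩ := hb z (hmem z (ball_subset_closedBall hz))
      obtain ⟨n, hn⟩ := exists_nat_ge C
      exact ⟨n, Or.inl ⟨ball_subset_closedBall hz, fun t ht => (hC t ht).trans hn⟩⟩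
    · exact ⟨0, Or.inr hz⟩
  obtain ⟨z₀, hz₀, hz₀'⟩ := (dense_iUnion_interior_of_closed hAc hAu).inter_open_nonempty
    (ball 0 (1 / 2)) isOpen_ball ⟨0, mem_ball_self (by norm_num)⟩
  obtain ⟨n, hn⟩ := Set.mem_iUnion.1 hz₀'
  obtain ⟨ε, hε, hεA⟩ := Metric.mem_nhds_iff.1
    (Filter.inter_mem (mem_interior_iff_mem_nhds.1 hn) (isOpen_ball.mem_nhds hz₀))
  refine ⟨z₀, hz₀, min ε (1 / 4), by positivity, min_le_right _ _, n, fun z hz t ht => ?_⟩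
  have := hεA (ball_subset_ball (min_le_left _ _) hz)
  rcases this with ⟨h | h, h'⟩
  · exact h.2 t ht
  · exact absurd h' h

open Metric in
/-- A family of univalent functions on the unit disk depending continuously (pointwise) on a
parameter in a compact set is locally uniformly bounded. -/
lemma exists_bound_of_injOn {K : Set ℝ} (hK : IsCompact K) {f : ℂ → ℝ → ℂ}
    (hol : ∀ t ∈ K, DifferentiableOn ℂ (fun z => f z t) (ball 0 1))
    (hinj : ∀ t ∈ K, Set.InjOn (fun z => f z t) (ball 0 1))
    (hcont : ∀ z ∈ ball (0 : ℂ) 1, ContinuousOn (f z) K) {r : ℝ} (hr : r < 1) :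
    ∃ C : ℝ, ∀ z ∈ closedBall (0 : ℂ) r, ∀ t ∈ K, ‖f z t‖ ≤ C := by
  wlog hr' : 3 / 4 ≤ r generalizing r
  · obtain ⟨C, hC⟩ := this (r := 3 / 4) (by norm_num) le_rfl
    exact ⟨C, fun z hz => hC z (closedBall_subset_closedBall (by linarith) hz)⟩
  obtain ⟨z₀, hz₀, ε, hε, hε', C, hC⟩ := exists_ball_bounded (fun t ht => (hol t ht).continuousOn)
    (fun z hz => hK.exists_bound_of_continuousOn (hcont z hz))
  rw [mem_ball_zero_iff] at hz₀
  set δ := ε / 2 with hδ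
  have hδ0 : 0 < δ := by positivity
  have hball : ball z₀ ε ⊆ ball 0 1 := ball_subset_ball' (by rw [dist_zero_right]; linarith)
  have hcb : closedBall z₀ δ ⊆ ball z₀ ε := closedBall_subset_ball (by linarith)
  have hz₀' : z₀ ∈ ball (0 : ℂ) 1 := hball (mem_ball_self hε)
  have hz₀K : ContinuousOn (fun x : ℂ × ℝ => f z₀ x.2) (Set.univ ×ˢ K) :=
    (hcont z₀ hz₀').comp continuousOn_snd fun x hx => hx.2
  have hjoint := continuousOn_uncurry_of_bounded isOpen_ball
    (fun t ht => (hol t ht).mono hball) (fun z hz => hcont z (hball hz)) hC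
  have hdiff : ContinuousOn (fun x : ℂ × ℝ => f x.1 x.2 - f z₀ x.2) (sphere z₀ δ ×ˢ K) :=
    (hjoint.mono (Set.prod_mono (sphere_subset_closedBall.trans hcb) subset_rfl)).sub
      (hz₀K.mono (Set.prod_mono (Set.subset_univ _) subset_rfl))
  obtain ⟨η, hη, hη'⟩ := ((isCompact_sphere z₀ δ).prod hK).exists_forall_le'
    (f := fun x : ℂ × ℝ => ‖f x.1 x.2 - f z₀ x.2‖) (a := 0) hdiff.norm
    (by
      rintro ⟨z, t⟩ ⟨hz, ht⟩
      rw [norm_pos_iff, sub_ne_zero]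
      intro h
      have := hinj t ht (hball (hcb (sphere_subset_closedBall hz))) hz₀' h
      rw [this, mem_sphere, dist_self] at hz
      exact hδ0.ne hz)
  have hfar : ∀ t ∈ K, ∀ z ∈ ball (0 : ℂ) 1 \ closedBall z₀ δ, η / 2 ≤ ‖f z t - f z₀ t‖ := by
    intro t ht z hz
    by_contra! hlt
    have hfreq : ∃ᶠ z in 𝓝 z₀, f z t ≠ f z₀ t := by
      have h1 : ∀ᶠ z in 𝓝[≠] z₀, f z t ≠ f z₀ t := by
        filter_upwards [self_mem_nhdsWithin,
          mem_nhdsWithin_of_mem_nhds (isOpen_ball.mem_nhds hz₀')] with z hz hz' h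
        exact hz (hinj t ht hz' hz₀' h)
      exact h1.frequently.filter_mono nhdsWithin_le_nhds
    obtain ⟨y, hy, hyz⟩ := ((hol t ht).diffContOnCl_ball
      (hcb.trans hball)).ball_subset_image_closedBall hδ0 (fun z hz => hη' (z, t) ⟨hz, ht⟩) hfreq
      (show f z t ∈ _ by rwa [mem_ball, dist_eq_norm])
    exact hz.2 (hinj t ht (hball (hcb hy)) hz.1 hyz ▸ hy)
  have hU : IsOpen (ball (0 : ℂ) 1 \ closedBall z₀ δ) := isOpen_ball.sdiff isClosed_closedBall
  have hne : ∀ t ∈ K, ∀ z ∈ ball (0 : ℂ) 1 \ closedBall z₀ δ, f z t - f z₀ t ≠ 0 := by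
    intro t ht z hz
    rw [← norm_pos_iff]
    linarith [hfar t ht z hz]
  have hinv := continuousOn_uncurry_of_bounded (f := fun z t => (f z t - f z₀ t)⁻¹) (K := K)
    (C := (η / 2)⁻¹) hU
    (fun t ht => (((hol t ht).mono Set.sdiff_subset).sub_const _).inv (hne t ht))
    (fun z hz => ((hcont z hz.1).sub (hcont z₀ hz₀')).inv₀ fun t ht => hne t ht z hz)
    (fun z hz t ht => by
      rw [norm_inv]
      exact inv_anti₀ (by positivity) (hfar t ht z hz))
  have hsph : sphere (0 : ℂ) r ⊆ ball (0 : ℂ) 1 \ closedBall z₀ δ := by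
    intro z hz
    rw [mem_sphere_zero_iff_norm] at hz
    refine ⟨by rw [mem_ball_zero_iff]; linarith, fun h => ?_⟩
    rw [mem_closedBall, dist_eq_norm] at h
    linarith [norm_sub_norm_le z z₀]
  obtain ⟨κ, hκ, hκ'⟩ := ((isCompact_sphere (0 : ℂ) r).prod hK).exists_forall_le'
    (f := fun x : ℂ × ℝ => ‖(f x.1 x.2 - f z₀ x.2)⁻¹‖) (a := 0)
    ((hinv.mono (Set.prod_mono hsph subset_rfl)).norm)
    (by
      rintro ⟨z, t⟩ ⟨hz, ht⟩
      exact norm_pos_iff.2 (inv_ne_zero (hne t ht z (hsph hz))))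
  refine ⟨C + κ⁻¹, fun z hz t ht => ?_⟩
  have hr0 : r ≠ 0 := by linarith
  refine Complex.norm_le_of_forall_mem_frontier_norm_le (U := ball 0 r) isBounded_ball
    ((hol t ht).diffContOnCl_ball (closedBall_subset_ball hr)) (fun w hw => ?_)
    (by rwa [closure_ball _ hr0])
  rw [frontier_ball _ hr0] at hw
  have h1 : ‖f w t - f z₀ t‖ ≤ κ⁻¹ := by
    have := hκ' (w, t) ⟨hw, ht⟩
    rw [norm_inv] at this
    exact (le_inv_comm₀ hκ (norm_pos_iff.2 (hne t ht w (hsph hw)))).1 this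
  have h2 := hC z₀ (mem_ball_self hε) t ht
  linarith [norm_le_norm_sub_add (f w t) (f z₀ t)]

/-- A function on `[0, b]` attaining its maximum at the right end of an interval has nonnegative
one-sided derivative there. -/
lemma nonneg_of_hasDerivWithinAt_of_forall_le {φ : ℝ → ℝ} {φ' T t₀ : ℝ} (ht₀ : 0 < t₀)
    (ht₀T : t₀ < T) (hφ : HasDerivWithinAt φ φ' (Set.Ico 0 T) t₀)
    (hmax : ∀ t ∈ Set.Icc 0 t₀, φ t ≤ φ t₀) : 0 ≤ φ' := by
  have h1 : HasDerivWithinAt φ φ' (Set.Icc 0 t₀) t₀ :=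
    hφ.mono fun t ht => ⟨ht.1, ht.2.trans_lt ht₀T⟩
  rw [hasDerivWithinAt_iff_tendsto_slope, Set.Icc_sdiff_right] at h1
  have : (𝓝[Set.Ico 0 t₀] t₀).NeBot := by
    rw [nhdsWithin_Ico_eq_nhdsLT ht₀]; infer_instance
  refine ge_of_tendsto h1 ?_
  filter_upwards [self_mem_nhdsWithin] with t ht
  rw [slope_def_field]
  exact div_nonneg_of_nonpos (by linarith [hmax t ⟨ht.1, ht.2.le⟩]) (by linarith [ht.2])

open Metric in
/-- If `ζ ↦ Re (v ζ)` composed with `g` is maximal over a centred closed ball at `z₀`, then the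
derivative of `g` in any direction `-z₀ w` with `Re w > 0` has nonpositive pairing with `v`. -/
lemma re_mul_deriv_nonpos {g : ℂ → ℂ} {g' z₀ v w : ℂ} {r : ℝ} (hz₀ : z₀ ∈ closedBall (0 : ℂ) r)
    (hg : HasDerivAt g g' z₀) (hmax : ∀ z ∈ closedBall (0 : ℂ) r, (v * g z).re ≤ (v * g z₀).re)
    (hw : 0 < w.re) : (v * (g' * (-(z₀ * w)))).re ≤ 0 := by
  have hl : HasDerivAt (fun s : ℝ => z₀ + (s : ℂ) * (-(z₀ * w))) (-(z₀ * w)) 0 := by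
    simpa using ((Complex.ofRealCLM.hasDerivAt (x := 0)).mul_const (-(z₀ * w))).const_add z₀
  have hc : HasDerivAt (fun s : ℝ => (v * g (z₀ + (s : ℂ) * (-(z₀ * w)))).re)
      (v * (g' * (-(z₀ * w)))).re 0 := by
    have h1 : HasDerivAt g g' (z₀ + ((0 : ℝ) : ℂ) * (-(z₀ * w))) := by simpa using hg
    have h2 := (h1.comp (0 : ℝ) hl).const_mul v
    exact (Complex.reCLM.hasFDerivAt.comp_hasDerivAt (0 : ℝ) h2)
  have h3 := hc.hasDerivWithinAt (s := Set.Ioi 0)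
  rw [hasDerivWithinAt_iff_tendsto_slope, Set.sdiff_singleton_eq_self (by simp)] at h3
  refine le_of_tendsto h3 ?_
  have hev : ∀ᶠ s : ℝ in 𝓝[>] 0, s * ‖w‖ ^ 2 < 2 * w.re := by
    have : Tendsto (fun s : ℝ => s * ‖w‖ ^ 2) (𝓝 0) (𝓝 (0 * ‖w‖ ^ 2)) :=
      tendsto_id.mul_const _
    rw [zero_mul] at this
    exact nhdsWithin_le_nhds (this.eventually_lt_const (by linarith))
  filter_upwards [hev, self_mem_nhdsWithin] with s hs hs0
  have hs0 : 0 < s := hs0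
  rw [slope_def_field]
  refine div_nonpos_of_nonpos_of_nonneg ?_ (by linarith)
  rw [sub_nonpos]
  have hin : z₀ + (s : ℂ) * (-(z₀ * w)) ∈ closedBall (0 : ℂ) r := by
    rw [mem_closedBall_zero_iff] at hz₀ ⊢
    have h4 : z₀ + (s : ℂ) * (-(z₀ * w)) = z₀ * (1 - s * w) := by ring
    have h5 : ‖1 - (s : ℂ) * w‖ ≤ 1 := by
      rw [← sq_le_one_iff₀ (norm_nonneg _), ← Complex.normSq_eq_norm_sq, Complex.normSq_apply]
      rw [← Complex.normSq_eq_norm_sq, Complex.normSq_apply] at hs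
      simp
      nlinarith
    rw [h4, norm_mul]
    exact (mul_le_of_le_one_right (norm_nonneg _) h5).trans hz₀
  simpa using hmax _ hin

open Metric in
/-- Maximum principle for the inhomogeneous Löwner–Kufarev equation. -/
lemma norm_le_of_loewner_kufarev {e ez p ρ : ℂ → ℝ → ℂ} {r T b ε : ℝ} (hbT : b < T)
    (he : ContinuousOn (Function.uncurry e) (closedBall 0 r ×ˢ Set.Icc 0 b))
    (he0 : ∀ z ∈ closedBall (0 : ℂ) r, e z 0 = 0)
    (hez : ∀ t ∈ Set.Icc 0 b, ∀ z ∈ closedBall (0 : ℂ) r,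
      HasDerivAt (fun x => e x t) (ez z t) z)
    (het : ∀ z ∈ closedBall (0 : ℂ) r, ∀ t ∈ Set.Icc 0 b,
      HasDerivWithinAt (e z) (-(z * ez z t * p z t) + ρ z t) (Set.Ico 0 T) t)
    (hp : ∀ t ∈ Set.Icc 0 b, ∀ z ∈ closedBall (0 : ℂ) r, 0 < (p z t).re)
    (hρ : ∀ z ∈ closedBall (0 : ℂ) r, ∀ t ∈ Set.Icc 0 b, ‖ρ z t‖ ≤ ε) :
    ∀ z ∈ closedBall (0 : ℂ) r, ∀ t ∈ Set.Icc 0 b, ‖e z t‖ ≤ ε * t := by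
  intro z₁ hz₁ t₁ ht₁
  have main : ∀ ε' > ε, ‖e z₁ t₁‖ ≤ ε' * t₁ := by
    intro ε' hε'
    by_contra! hlt
    obtain ⟨⟨z₀, t₀⟩, ⟨hz₀, ht₀⟩, hmax⟩ :=
      ((isCompact_closedBall (0 : ℂ) r).prod (isCompact_Icc (a := 0) (b := b))).exists_isMaxOn
        ⟨(z₁, t₁), hz₁, ht₁⟩ (f := fun x : ℂ × ℝ => ‖e x.1 x.2‖ - ε' * x.2)
        (he.norm.sub (by fun_prop))
    replace hz₀ : z₀ ∈ closedBall (0 : ℂ) r := hz₀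
    replace ht₀ : t₀ ∈ Set.Icc 0 b := ht₀
    have hmax' : ∀ z ∈ closedBall (0 : ℂ) r, ∀ t ∈ Set.Icc 0 b,
        ‖e z t‖ - ε' * t ≤ ‖e z₀ t₀‖ - ε' * t₀ := fun z hz t ht =>
      hmax (a := (z, t)) ⟨hz, ht⟩
    have hpos : 0 < ‖e z₀ t₀‖ - ε' * t₀ := by linarith [hmax' z₁ hz₁ t₁ ht₁]
    have ht₀0 : 0 < t₀ := by
      rcases ht₀.1.eq_or_lt with h | h
      · rw [← h, he0 z₀ hz₀] at hpos
        simp at hpos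
      · exact h
    obtain ⟨v, hv, hv'⟩ : ∃ v : ℂ, ‖v‖ ≤ 1 ∧ v * e z₀ t₀ = (‖e z₀ t₀‖ : ℂ) := by
      rcases eq_or_ne (e z₀ t₀) 0 with h | h
      · exact ⟨0, by simp, by simp [h]⟩
      · refine ⟨‖e z₀ t₀‖ / e z₀ t₀, ?_, by field_simp⟩
        rw [norm_div, Complex.norm_real, norm_norm, div_self (norm_ne_zero_iff.2 h)]
    have hre : ∀ x : ℂ, (v * x).re ≤ ‖x‖ := fun x =>
      (Complex.re_le_norm _).trans (by
        rw [norm_mul]; exact mul_le_of_le_one_left (norm_nonneg _) hv)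
    have hv'' : (v * e z₀ t₀).re = ‖e z₀ t₀‖ := by rw [hv', Complex.ofReal_re]
    have h1 : 0 ≤ (v * (-(z₀ * ez z₀ t₀ * p z₀ t₀) + ρ z₀ t₀)).re - ε' := by
      refine nonneg_of_hasDerivWithinAt_of_forall_le (φ := fun t => (v * e z₀ t).re - ε' * t)
        ht₀0 (ht₀.2.trans_lt hbT) ?_ fun t ht => ?_
      · have hd := (het z₀ hz₀ t₀ ht₀).const_mul v
        exact (Complex.reCLM.hasFDerivAt.comp_hasDerivWithinAt t₀ hd).sub
          (by simpa using (hasDerivWithinAt_id t₀ _).const_mul ε')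
      · have := hmax' z₀ hz₀ t ⟨ht.1, ht.2.trans ht₀.2⟩
        linarith [hre (e z₀ t)]
    have h2 := re_mul_deriv_nonpos (v := v) hz₀ (hez t₀ ht₀ z₀ hz₀)
      (fun z hz => by
        have := hmax' z hz t₀ ht₀
        linarith [hre (e z t₀)]) (hp t₀ ht₀ z₀ hz₀)
    have h3 := (hre (ρ z₀ t₀)).trans (hρ z₀ hz₀ t₀ ht₀)
    have h4 : v * (-(z₀ * ez z₀ t₀ * p z₀ t₀) + ρ z₀ t₀) =
        v * (ez z₀ t₀ * (-(z₀ * p z₀ t₀))) + v * ρ z₀ t₀ := by ring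
    rw [h4, Complex.add_re] at h1
    linarith
  have : Tendsto (fun ε' : ℝ => ε' * t₁) (𝓝[>] ε) (𝓝 (ε * t₁)) :=
    (tendsto_id.mul_const _).mono_left nhdsWithin_le_nhds
  exact ge_of_tendsto this (eventually_nhdsWithin_of_forall main)

open Metric in
/-- If the real part of a function continuous on the closed unit disk and holomorphic inside is
nonpositive on the circle, then it is nonpositive at the centre. -/
lemma re_zero_nonpos_of_sphere {u : ℂ → ℂ} (hu : DiffContOnCl ℂ u (ball 0 1))
    (h : ∀ w ∈ sphere (0 : ℂ) 1, (u w).re ≤ 0) : (u 0).re ≤ 0 := by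
  have h1 : ‖Complex.exp (u 0)‖ ≤ 1 := by
    refine Complex.norm_le_of_forall_mem_frontier_norm_le (f := Complex.exp ∘ u)
      (isBounded_ball (x := (0 : ℂ)) (r := 1))
      (Complex.differentiable_exp.comp_diffContOnCl hu) (fun z hz => ?_)
      (subset_closure (mem_ball_self one_pos))
    rw [frontier_ball _ one_ne_zero] at hz
    rw [Function.comp, Complex.norm_exp]
    exact Real.exp_le_one_iff.2 (h z hz)
  rwa [Complex.norm_exp, Real.exp_le_one_iff] at h1

open Metric in
/-- The bounded region enclosed by the image of the circle is not part of an unbounded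
complementary component. -/
lemma notMem_unbounded_component {f : ℂ → ℂ} (hf : DiffContOnCl ℂ f (ball 0 1))
    (hinj : Set.InjOn f (ball 0 1)) {x y : ℂ} (hy : y ∈ ball (0 : ℂ) 1)
    (hx : ¬ Bornology.IsBounded (connectedComponentIn (f '' sphere 0 1)ᶜ x)) :
    f y ∉ connectedComponentIn (f '' sphere 0 1)ᶜ x := by
  intro hmem
  have hcl : closure (ball (0 : ℂ) 1) = closedBall 0 1 := closure_ball _ one_ne_zero
  have hcb : IsCompact (f '' closedBall 0 1) :=
    (isCompact_closedBall _ _).image_of_continuousOn (hcl ▸ hf.continuousOn)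
  have hopen : IsOpen (f '' ball 0 1) := by
    rcases (hf.differentiableOn.analyticOnNhd isOpen_ball).is_constant_or_isOpen
      (convex_ball _ _).isPreconnected with ⟨w, hw⟩ | h
    · have h0 : (0 : ℂ) ∈ ball (0 : ℂ) 1 := by simp
      have h1 : (1 / 2 : ℂ) ∈ ball (0 : ℂ) 1 := by simp; norm_num
      have := hinj h0 h1 ((hw _ h0).trans (hw _ h1).symm)
      norm_num at this
    · exact h _ subset_rfl isOpen_ball
  refine hx (hcb.isBounded.subset (Set.Subset.trans ?_ (Set.image_mono ball_subset_closedBall)))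
  refine isPreconnected_connectedComponentIn.subset_of_closure_inter_subset hopen
    ⟨f y, hmem, Set.mem_image_of_mem _ hy⟩ ?_
  rintro z ⟨hz, hz'⟩
  obtain ⟨w, hw, rfl⟩ := closure_minimal (Set.image_mono ball_subset_closedBall) hcb.isClosed hz
  rcases (mem_closedBall.1 hw).lt_or_eq with h | h
  · exact Set.mem_image_of_mem _ h
  · exact absurd (Set.mem_image_of_mem f h) (connectedComponentIn_subset _ _ hz')

open Metric in
/-- A function with bounded derivative on the open unit disk and continuous up to the boundary is
Lipschitz on the closed disk. -/
lemma lipschitzOnWith_closedBall_of_norm_deriv_le {g g' : ℂ → ℂ} {C : ℝ}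
    (hg : ∀ z ∈ ball (0 : ℂ) 1, HasDerivAt g (g' z) z) (hc : ContinuousOn g (closedBall 0 1))
    (hC : ∀ z ∈ ball (0 : ℂ) 1, ‖g' z‖ ≤ C) :
    LipschitzOnWith C.toNNReal g (closedBall 0 1) := by
  rw [← closure_ball (0 : ℂ) one_ne_zero] at hc ⊢
  exact (Convex.lipschitzOnWith_of_nnnorm_hasDerivWithin_le (convex_ball _ _)
    (fun x hx => (hg x hx).hasDerivWithinAt)
    fun x hx => NNReal.le_toNNReal_of_coe_le (hC x hx)).closure hc

open Metric in
/-- A family of equi-Lipschitz functions on the closed disk, continuous in the parameter, is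
uniformly continuous in the parameter at `0`. -/
lemma exists_uniform_of_lipschitz {p : ℂ → ℝ → ℂ} {T : ℝ} (hT : 0 < T) {C : NNReal}
    (hp : ∀ t ∈ Set.Ico (0 : ℝ) T, LipschitzOnWith C (fun z => p z t) (closedBall 0 1))
    (hpt : ∀ z ∈ closedBall (0 : ℂ) 1, ContinuousOn (p z) (Set.Ico 0 T)) {ε : ℝ} (hε : 0 < ε) :
    ∃ δ > 0, ∀ z ∈ closedBall (0 : ℂ) 1, ∀ t ∈ Set.Ico 0 T, t < δ → ‖p z t - p z 0‖ ≤ ε := by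
  have hsub : Set.Icc 0 (T / 2) ⊆ Set.Ico 0 T := fun t ht => ⟨ht.1, by linarith [ht.2]⟩
  have hjoint : ContinuousOn (Function.uncurry p) (closedBall 0 1 ×ˢ Set.Icc 0 (T / 2)) :=
    continuousOn_prod_of_continuousOn_lipschitzOnWith _ C
      (fun z hz => (hpt z hz).mono hsub) fun t ht => hp t (hsub ht)
  have hu := ((isCompact_closedBall (0 : ℂ) 1).prod
    isCompact_Icc).uniformContinuousOn_of_continuous hjoint
  obtain ⟨δ, hδ, h⟩ := Metric.uniformContinuousOn_iff.1 hu ε hε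
  refine ⟨min δ (T / 2), by positivity, fun z hz t ht htδ => ?_⟩
  have ht0 : |t| = t := abs_of_nonneg ht.1
  have := h (z, t) ⟨hz, ht.1, (htδ.le.trans (min_le_right _ _))⟩ (z, 0)
    ⟨hz, le_rfl, by positivity⟩ (by
      rw [Prod.dist_eq, dist_self, Real.dist_eq, sub_zero, ht0]
      exact max_lt hδ (htδ.trans_le (min_le_left _ _)))
  rw [dist_eq_norm] at this
  exact this.le

open Metric in
/-- First-order expansion in time, uniform up to the boundary, of univalent solutions of the
Löwner–Kufarev equation starting at the identity. -/
lemma loewner_kufarev_expansion {T : ℝ} (hT : 0 < T) {p p' : ℂ → ℝ → ℂ}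
    (hp_cont : ∀ t ∈ Set.Ico (0 : ℝ) T, ContinuousOn (fun z => p z t) (closedBall (0 : ℂ) 1))
    (hp_re : ∀ t ∈ Set.Ico (0 : ℝ) T, ∀ z ∈ ball (0 : ℂ) 1, 0 < (p z t).re)
    (hp' : ∀ t ∈ Set.Ico (0 : ℝ) T, ∀ z ∈ ball (0 : ℂ) 1,
      HasDerivAt (fun x => p x t) (p' z t) z)
    (hp_t : ∀ z ∈ closedBall (0 : ℂ) 1, ContinuousOn (fun t => p z t) (Set.Ico 0 T))
    {M M' : ℝ}
    (hp_bdd : ∀ z ∈ closedBall (0 : ℂ) 1, ∀ t ∈ Set.Ico (0 : ℝ) T, ‖p z t‖ ≤ M)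
    (hp'_bdd : ∀ z ∈ closedBall (0 : ℂ) 1, ∀ t ∈ Set.Ico (0 : ℝ) T, ‖p' z t‖ ≤ M')
    {f fz : ℂ → ℝ → ℂ}
    (hf_init : ∀ z ∈ ball (0 : ℂ) 1, f z 0 = z)
    (hf_inj : ∀ t ∈ Set.Ico (0 : ℝ) T, Set.InjOn (fun z => f z t) (ball (0 : ℂ) 1))
    (hf_cl : ∀ t ∈ Set.Ico (0 : ℝ) T, ContinuousOn (fun z => f z t) (closedBall (0 : ℂ) 1))
    (hfz : ∀ t ∈ Set.Ico (0 : ℝ) T, ∀ z ∈ ball (0 : ℂ) 1,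
      HasDerivAt (fun x => f x t) (fz z t) z)
    (hf_pde : ∀ z ∈ ball (0 : ℂ) 1, ∀ t ∈ Set.Ico (0 : ℝ) T,
      HasDerivWithinAt (fun u => f z u) (-(z * fz z t * p z t)) (Set.Ico 0 T) t)
    {ε : ℝ} (hε : 0 < ε) :
    ∀ᶠ t in 𝓝[>] (0 : ℝ), ∀ z ∈ closedBall (0 : ℂ) 1, ‖f z t - z * (1 - t * p z 0)‖ ≤ ε * t := by
  have h00 : (0 : ℝ) ∈ Set.Ico 0 T := ⟨le_rfl, hT⟩
  have h0 : (0 : ℂ) ∈ closedBall (0 : ℂ) 1 := mem_closedBall_self zero_le_one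
  have hM : 0 ≤ M := (norm_nonneg _).trans (hp_bdd 0 h0 0 h00)
  have hM' : 0 ≤ M' := (norm_nonneg _).trans (hp'_bdd 0 h0 0 h00)
  obtain ⟨δ, hδ, hδp⟩ := exists_uniform_of_lipschitz hT
    (fun t ht => lipschitzOnWith_closedBall_of_norm_deriv_le (hp' t ht) (hp_cont t ht)
      fun z hz => hp'_bdd z (ball_subset_closedBall hz) t ht) hp_t (half_pos hε)
  have hev : ∀ᶠ b in 𝓝[>] (0 : ℝ), b * (M * (M + M')) < ε / 2 := by
    have : Tendsto (fun b : ℝ => b * (M * (M + M'))) (𝓝 0) (𝓝 (0 * (M * (M + M')))) :=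
      tendsto_id.mul_const _
    rw [zero_mul] at this
    exact nhdsWithin_le_nhds (this.eventually_lt_const (by positivity))
  filter_upwards [hev, Ioo_mem_nhdsGT (lt_min hδ hT)] with b hb ⟨hb0, hbδ⟩
  have hbT : b < T := hbδ.trans_le (min_le_right _ _)
  have hI : Set.Icc 0 b ⊆ Set.Ico 0 T := fun t ht => ⟨ht.1, ht.2.trans_lt hbT⟩
  have hball : ∀ z ∈ ball (0 : ℂ) 1, ‖f z b - z * (1 - b * p z 0)‖ ≤ ε * b := by
    intro z₁ hz₁
    have hz₁' : ‖z₁‖ < 1 := mem_ball_zero_iff.1 hz₁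
    have hr : closedBall (0 : ℂ) ‖z₁‖ ⊆ ball 0 1 := closedBall_subset_ball hz₁'
    have hf_hol : ∀ t ∈ Set.Icc 0 b, DifferentiableOn ℂ (fun z => f z t) (ball 0 1) :=
      fun t ht z hz => (hfz t (hI ht) z hz).differentiableAt.differentiableWithinAt
    have hf_t : ∀ z ∈ ball (0 : ℂ) 1, ContinuousOn (f z) (Set.Icc 0 b) := fun z hz t ht =>
      ((hf_pde z hz t (hI ht)).continuousWithinAt).mono hI
    obtain ⟨r, hr₁, hr₂⟩ := exists_between hz₁'
    obtain ⟨C, hC⟩ := exists_bound_of_injOn isCompact_Icc hf_hol (fun t ht => hf_inj t (hI ht))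
      hf_t hr₂
    have hrr : ball (0 : ℂ) r ⊆ ball 0 1 := ball_subset_ball hr₂.le
    have hfjoint := (continuousOn_uncurry_of_bounded isOpen_ball
      (fun t ht => (hf_hol t ht).mono hrr) (fun z hz => hf_t z (hrr hz))
      (fun z hz => hC z (ball_subset_closedBall hz))).mono
      (Set.prod_mono (closedBall_subset_ball hr₁) subset_rfl)
    have hp0 : ContinuousOn (fun x : ℂ × ℝ => p x.1 0)
        (closedBall (0 : ℂ) ‖z₁‖ ×ˢ Set.Icc 0 b) :=
      (hp_cont 0 h00).comp continuousOn_fst fun x hx => ball_subset_closedBall (hr hx.1)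
    refine norm_le_of_loewner_kufarev (e := fun z t => f z t - z * (1 - t * p z 0))
      (ez := fun z t => fz z t - (1 - t * p z 0 + z * (-(t * p' z 0)))) (p := p)
      (ρ := fun z t => z * (p z 0 - p z t) + z * p z t * (t * (p z 0 + z * p' z 0)))
      (r := ‖z₁‖) (T := T) (b := b) (ε := ε) hbT ?_ ?_ ?_ ?_ ?_ ?_ z₁ (by simp) b ⟨hb0.le, le_rfl⟩
    · have ht : Continuous fun x : ℂ × ℝ => (x.2 : ℂ) := Complex.continuous_ofReal.comp continuous_snd
      exact hfjoint.sub
        (continuousOn_fst.mul (continuousOn_const.sub (ht.continuousOn.mul hp0)))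
    · intro z hz
      simp [hf_init z (hr hz)]
    · intro t ht z hz
      have h1 := ((hp' 0 h00 z (hr hz)).const_mul (t : ℂ)).const_sub 1
      have h2 := (hasDerivAt_id z).mul h1
      refine ((hfz t (hI ht) z (hr hz)).sub h2).congr_deriv ?_
      simp
    · intro z hz t ht
      have h1 : HasDerivWithinAt (fun t : ℝ => z * (1 - (t : ℂ) * p z 0)) (z * (-p z 0))
          (Set.Ico 0 T) t := by
        have := ((((Complex.ofRealCLM.hasDerivAt (x := t)).mul_const (p z 0)).const_sub
          1).const_mul z).hasDerivWithinAt (s := Set.Ico 0 T)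
        simpa using this
      refine ((hf_pde z (hr hz) t (hI ht)).sub h1).congr_deriv ?_
      ring
    · exact fun t ht z hz => hp_re t (hI ht) z (hr hz)
    · intro z hz t ht
      have hz' : z ∈ closedBall (0 : ℂ) 1 := ball_subset_closedBall (hr hz)
      have hzn : ‖z‖ ≤ 1 := mem_closedBall_zero_iff.1 hz'
      have hmul : ∀ x : ℂ, ‖z * x‖ ≤ ‖x‖ := fun x => by
        rw [norm_mul]; exact mul_le_of_le_one_left (norm_nonneg _) hzn
      have h1 : ‖z * (p z 0 - p z t)‖ ≤ ε / 2 := by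
        refine (hmul _).trans ?_
        rw [norm_sub_rev]
        exact hδp z hz' t (hI ht) (ht.2.trans_lt (hbδ.trans_le (min_le_left _ _)))
      have h2 : ‖p z 0 + z * p' z 0‖ ≤ M + M' :=
        norm_add_le_of_le (hp_bdd z hz' 0 h00) ((hmul _).trans (hp'_bdd z hz' 0 h00))
      have h3 : ‖z * p z t * (t * (p z 0 + z * p' z 0))‖ ≤ M * (b * (M + M')) := by
        rw [norm_mul, norm_mul (t : ℂ), Complex.norm_real, Real.norm_of_nonneg ht.1]
        exact mul_le_mul ((hmul _).trans (hp_bdd z hz' t (hI ht)))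
          (mul_le_mul ht.2 h2 (norm_nonneg _) hb0.le) (by have := ht.1; positivity) hM
      linarith [norm_add_le_of_le h1 h3]
  have hsub : ball (0 : ℂ) 1 ⊆
      {z ∈ closedBall (0 : ℂ) 1 | ‖f z b - z * (1 - b * p z 0)‖ ≤ ε * b} :=
    fun x hx => ⟨ball_subset_closedBall hx, hball x hx⟩
  have hclosed : IsClosed {z ∈ closedBall (0 : ℂ) 1 | ‖f z b - z * (1 - b * p z 0)‖ ≤ ε * b} :=
    ContinuousOn.preimage_isClosed_of_isClosed (f := fun z => ‖f z b - z * (1 - b * p z 0)‖)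
      ((hf_cl b ⟨hb0.le, hbT⟩).sub (continuousOn_id.mul
        (continuousOn_const.sub (continuousOn_const.mul (hp_cont 0 h00))))).norm
      isClosed_closedBall isClosed_Iic
  intro z hz
  rw [← closure_ball (0 : ℂ) one_ne_zero] at hz
  exact (closure_minimal hsub hclosed hz).2

open Metric in
/-- Inversion turns a function on the exterior disk with a simple pole at infinity into a function
on the unit disk. -/
lemma exists_diffContOnCl_of_exterior {G : ℂ → ℂ} {c b : ℂ}
    (hol : DifferentiableOn ℂ G {z | 1 < ‖z‖}) (hcl : ContinuousOn G {z | 1 ≤ ‖z‖})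
    (hexp : Tendsto (fun z => G z - c * z) (Bornology.cobounded ℂ) (𝓝 b)) :
    ∃ g : ℂ → ℂ, DiffContOnCl ℂ g (ball 0 1) ∧ g 0 = c ∧ ∀ w ≠ 0, g w = w * G w⁻¹ := by
  classical
  let g : ℂ → ℂ := Function.update (fun w => w * G w⁻¹) 0 c
  have hg0 : g 0 = c := Function.update_self ..
  have hg : ∀ w ≠ 0, g w = w * G w⁻¹ := fun w hw => Function.update_of_ne hw ..
  have hat : ContinuousAt g 0 := by
    rw [continuousAt_update_same]
    have h1 := (hexp.comp tendsto_inv₀_nhdsNE_zero)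
    have h2 : Tendsto (fun w : ℂ => w) (𝓝[≠] 0) (𝓝 0) := tendsto_id.mono_left nhdsWithin_le_nhds
    have h3 := (h2.mul h1).add_const c
    rw [zero_mul, zero_add] at h3
    refine h3.congr' ?_
    filter_upwards [self_mem_nhdsWithin] with w hw
    have hw : w ≠ 0 := hw
    simp only [Function.comp]
    field_simp
    ring
  refine ⟨g, DiffContOnCl.mk_ball ?_ ?_, hg0, hg⟩
  · rw [← Complex.differentiableOn_compl_singleton_and_continuousAt_iff
      (ball_mem_nhds (0 : ℂ) one_pos)]
    refine ⟨?_, hat⟩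
    have : DifferentiableOn ℂ (fun w => w * G w⁻¹) (ball 0 1 \ {0}) := by
      refine differentiableOn_id.mul (hol.comp (differentiableOn_inv.mono fun w hw => hw.2) ?_)
      intro w hw
      have h0 : w ≠ 0 := hw.2
      have h1 : ‖w‖ < 1 := mem_ball_zero_iff.1 hw.1
      rw [Set.mem_ofPred_eq, norm_inv]
      exact (one_lt_inv₀ (norm_pos_iff.2 h0)).2 h1
    exact this.congr fun w hw => hg w hw.2
  · intro w hw
    rcases eq_or_ne w 0 with rfl | h0
    · exact hat.continuousWithinAt
    · have : ContinuousOn (fun w => w * G w⁻¹) (closedBall 0 1 \ {0}) := by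
        refine continuousOn_id.mul (hcl.comp (continuousOn_inv₀.mono fun w hw => hw.2) ?_)
        intro w hw
        have h0 : w ≠ 0 := hw.2
        have h1 : ‖w‖ ≤ 1 := mem_closedBall_zero_iff.1 hw.1
        rw [Set.mem_ofPred_eq, norm_inv]
        exact (one_le_inv₀ (norm_pos_iff.2 h0)).2 h1
      have h2 := (this.congr fun w hw => hg w hw.2) w ⟨hw, h0⟩
      refine h2.mono_of_mem_nhdsWithin ?_
      exact Filter.inter_mem self_mem_nhdsWithin
        (mem_nhdsWithin_of_mem_nhds (isOpen_compl_singleton.mem_nhds h0))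

open Metric in
/-- Two-sided bound for the value at the centre of a zero-free function whose modulus on the circle
is close to `1 - t Re P` for a holomorphic function `P` with `P 0 = 1`. -/
lemma center_bounds {g P : ℂ → ℂ} {c t ε M M' K : ℝ}
    (hg : DiffContOnCl ℂ g (ball 0 1)) (hP : DiffContOnCl ℂ P (ball 0 1)) (hP0 : P 0 = 1)
    (hg0 : g 0 = c) (hg_ne : ∀ w ∈ ball (0 : ℂ) 1, g w ≠ 0)
    (ht : 0 < t) (hε : 0 < ε) (hε1 : ε ≤ 1) (hM' : 0 ≤ M')
    (hPM : ∀ w ∈ sphere (0 : ℂ) 1, ‖P w‖ ≤ M) (hK : K = M + 1 + 3 * M') (htK : t * K ≤ 1 / 2)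
    (hgP : ∀ w ∈ sphere (0 : ℂ) 1,
      |‖g w‖ - (1 - t * (P w).re)| ≤ t * (ε + M' * ‖g w - 1‖)) :
    c ≤ 1 - t + t * (ε + M' * (ε + ((1 + t * K) ^ 2 + 1 - 2 * c) / (4 * ε))) ∧
    c⁻¹ ≤ 1 + t + t * (ε + M' * (ε + ((1 + t * K) ^ 2 + 1 - 2 * c) / (4 * ε))) +
      2 * (t * K) ^ 2 := by
  have hM : 0 ≤ M := (norm_nonneg _).trans (hPM 1 (by simp))
  have htM' : t * M' ≤ 1 / 6 := by nlinarith
  have aux : ∀ w ∈ sphere (0 : ℂ) 1, |t * (P w).re| + t * (ε + M' * ‖g w - 1‖) ≤ t * K ∧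
      t * (ε + M' * ‖g w - 1‖) ≤
        t * (ε + M' * (ε + ((1 + t * K) ^ 2 + 1 - 2 * (g w).re) / (4 * ε))) := by
    intro w hw
    have hA := abs_le.1 (hgP w hw)
    have hre : |(P w).re| ≤ M := (Complex.abs_re_le_norm _).trans (hPM w hw)
    have hre' := abs_le.1 hre
    set x := ‖g w - 1‖ with hx
    have hx0 : 0 ≤ x := norm_nonneg _
    have hx1 : x ≤ ‖g w‖ + 1 := by simpa using norm_sub_le (g w) 1
    have hn : ‖g w‖ ≤ 2 := by
      have h1 : t * -(P w).re ≤ t * M := by gcongr; linarith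
      have h2 : t * M' * x ≤ t * M' * (‖g w‖ + 1) := by gcongr
      have h3 : t * ε ≤ t * 1 := by gcongr
      have h4 : t * M' * ‖g w‖ ≤ 1 / 6 * ‖g w‖ := by gcongr
      subst hK
      nlinarith
    have hS : |t * (P w).re| + t * (ε + M' * x) ≤ t * K := by
      rw [abs_mul, abs_of_pos ht, ← mul_add]
      gcongr
      have : M' * x ≤ M' * 3 := by gcongr; linarith
      linarith
    refine ⟨hS, ?_⟩
    have hxsq : x ^ 2 = ‖g w‖ ^ 2 + 1 - 2 * (g w).re := by
      rw [hx, ← Complex.normSq_eq_norm_sq, ← Complex.normSq_eq_norm_sq, Complex.normSq_apply,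
        Complex.normSq_apply]
      simp
      ring
    have hn1 : ‖g w‖ ≤ 1 + t * K := by
      linarith [neg_abs_le (t * (P w).re)]
    have hn2 : ‖g w‖ ^ 2 ≤ (1 + t * K) ^ 2 := by gcongr
    gcongr
    have : x ≤ ε + x ^ 2 / (4 * ε) := by
      rw [← sub_nonneg]
      have : ε + x ^ 2 / (4 * ε) - x = (x - 2 * ε) ^ 2 / (4 * ε) := by field_simp; ring
      rw [this]
      positivity
    refine this.trans ?_
    gcongr
    linarith
  let E : ℂ → ℂ := fun w =>
    t * (ε + M' * (ε + (4 * ε : ℂ)⁻¹ * ((1 + t * K) ^ 2 + 1 - 2 * g w)))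
  have hE : DiffContOnCl ℂ E (ball 0 1) := by
    have h2 : DiffContOnCl ℂ (fun w => 2 * g w) (ball 0 1) := hg.const_smul (2 : ℂ)
    have h3 := ((h2.const_sub ((1 + t * K) ^ 2 + 1)).const_smul (4 * ε : ℂ)⁻¹).const_add (ε : ℂ)
    exact ((h3.const_smul (M' : ℂ)).const_add (ε : ℂ)).const_smul (t : ℂ)
  have hEre : ∀ w, (E w).re =
      t * (ε + M' * (ε + ((1 + t * K) ^ 2 + 1 - 2 * (g w).re) / (4 * ε))) := by
    intro w
    have : E w = ((t * (ε + M' * (ε + (4 * ε)⁻¹ * ((1 + t * K) ^ 2 + 1))) : ℝ) : ℂ) -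
        ((t * M' * (4 * ε)⁻¹ * 2 : ℝ) : ℂ) * g w := by
      simp only [E]
      push_cast
      ring
    rw [this, Complex.sub_re, Complex.ofReal_re, Complex.re_ofReal_mul]
    ring
  have htP : DiffContOnCl ℂ (fun w => t * P w) (ball 0 1) := hP.const_smul (t : ℂ)
  constructor
  · have := re_zero_nonpos_of_sphere (hg.sub ((htP.const_sub 1).add hE)) fun w hw => by
      have h1 := (abs_le.1 (hgP w hw)).2
      have h2 := (aux w hw).2
      have h3 := Complex.re_le_norm (g w)
      simp only [Pi.sub_apply, Pi.add_apply, Complex.sub_re, Complex.add_re, hEre,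
        Complex.re_ofReal_mul, Complex.one_re]
      linarith
    simp only [Pi.sub_apply, Pi.add_apply, Complex.sub_re, Complex.add_re, hEre,
      Complex.re_ofReal_mul, Complex.one_re, hP0, hg0, Complex.ofReal_re] at this
    linarith
  · have hpos : ∀ w ∈ sphere (0 : ℂ) 1, 0 < ‖g w‖ ∧
        ‖g w‖⁻¹ ≤ 1 + t * (P w).re + (E w).re + 2 * (t * K) ^ 2 := by
      intro w hw
      have h1 := (abs_le.1 (hgP w hw)).1
      obtain ⟨h2, h3⟩ := aux w hw
      rw [hEre]
      set s := t * (ε + M' * ‖g w - 1‖) with hs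
      have hs0 : 0 ≤ s := by positivity
      set y := t * (P w).re + s with hy
      have hya : |y| ≤ t * K := (abs_add_le _ _).trans (by rwa [abs_of_nonneg hs0])
      have hy1 : y ≤ 1 / 2 := (le_abs_self _).trans (hya.trans htK)
      have hy2 : y ^ 2 ≤ (t * K) ^ 2 := by
        rw [← sq_abs]; gcongr
      have h4 : 1 - y ≤ ‖g w‖ := by linarith
      have h5 : 0 < 1 - y := by linarith
      refine ⟨h5.trans_le h4, (inv_anti₀ h5 h4).trans ?_⟩
      have h6 : (1 - y)⁻¹ ≤ 1 + y + 2 * y ^ 2 := by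
        rw [inv_le_iff_one_le_mul₀ h5]
        nlinarith [sq_nonneg y]
      linarith
    have hne : ∀ w ∈ closure (ball (0 : ℂ) 1), g w ≠ 0 := by
      intro w hw
      rw [closure_ball _ one_ne_zero, mem_closedBall] at hw
      rcases hw.lt_or_eq with h | h
      · exact hg_ne w h
      · exact norm_pos_iff.1 (hpos w h).1
    have := re_zero_nonpos_of_sphere ((hg.inv hne).sub
        (((htP.const_add 1).add hE).add_const ((2 * (t * K) ^ 2 : ℝ) : ℂ))) fun w hw => by
      have h1 := (hpos w hw).2
      have h2 := Complex.re_le_norm (g w)⁻¹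
      rw [norm_inv] at h2
      simp only [Pi.sub_apply, Pi.add_apply, Pi.inv_apply, Complex.sub_re, Complex.add_re,
        Complex.re_ofReal_mul, Complex.one_re, Complex.ofReal_re]
      linarith
    simp only [Pi.sub_apply, Pi.add_apply, Pi.inv_apply, Complex.sub_re, Complex.add_re, hEre,
      Complex.re_ofReal_mul, Complex.one_re, hP0, hg0, Complex.ofReal_re,
      ← Complex.ofReal_inv] at this
    linarith

/-- The modulus of `1 - t a` to first order in `t`. -/
lemma abs_norm_one_sub_mul_sub_le {a : ℂ} {t M : ℝ} (ht : 0 ≤ t) (ha : ‖a‖ ≤ M)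
    (htM : t * M ≤ 1 / 2) : |‖1 - t * a‖ - (1 - t * a.re)| ≤ t ^ 2 * M ^ 2 := by
  have h1 : 1 - t * a.re ≤ ‖1 - t * a‖ := by
    simpa using Complex.re_le_norm (1 - t * a)
  rw [abs_of_nonneg (by linarith), sub_le_iff_le_add]
  have h2 : t * a.re ≤ 1 / 2 := by
    have : a.re ≤ M := (Complex.re_le_norm a).trans ha
    nlinarith
  have h3 : ‖a‖ ^ 2 ≤ M ^ 2 := by gcongr
  have h4 : a.im ^ 2 ≤ M ^ 2 := by
    rw [← Complex.normSq_eq_norm_sq, Complex.normSq_apply] at h3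
    nlinarith [sq_nonneg a.re]
  have h5 : t ^ 2 * a.im ^ 2 ≤ t ^ 2 * M ^ 2 := by gcongr
  have h6 : 0 ≤ t ^ 2 * M ^ 2 := by positivity
  refine le_of_sq_le_sq ?_ (by linarith)
  rw [← Complex.normSq_eq_norm_sq, Complex.normSq_apply]
  simp
  nlinarith

open Metric ComplexConjugate in
/-- Bounds for the logarithmic capacity `c` of a curve that is close to the circle of radius
`1 - t`, in terms of the first-order description `z (1 - t p z)` of an interior conformal map. -/
lemma capacity_bounds {f G p : ℂ → ℂ} {x b : ℂ} {c t ε M M' K : ℝ}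
    (hf : DiffContOnCl ℂ f (ball 0 1)) (hinj : Set.InjOn f (ball 0 1)) (hf0 : f 0 = 0)
    (hp : DiffContOnCl ℂ p (ball 0 1)) (hp0 : p 0 = 1)
    (hpM : ∀ z ∈ sphere (0 : ℂ) 1, ‖p z‖ ≤ M)
    (hpM' : LipschitzOnWith M'.toNNReal p (closedBall 0 1)) (hM' : 0 ≤ M')
    (hfp : ∀ z ∈ closedBall (0 : ℂ) 1, ‖f z - z * (1 - t * p z)‖ ≤ ε / 2 * t)
    (hol : DifferentiableOn ℂ G {z | 1 < ‖z‖}) (hcl : ContinuousOn G {z | 1 ≤ ‖z‖})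
    (hexp : Tendsto (fun z => G z - c * z) (Bornology.cobounded ℂ) (𝓝 b)) (hc : c ≠ 0)
    (hx : ¬ Bornology.IsBounded (connectedComponentIn (f '' sphere 0 1)ᶜ x))
    (honto : G '' {z | 1 < ‖z‖} = connectedComponentIn (f '' sphere 0 1)ᶜ x)
    (hweld : G '' sphere 0 1 = f '' sphere 0 1)
    (ht : 0 < t) (hε : 0 < ε) (hε1 : ε ≤ 1) (hK : K = M + 1 + 3 * M') (htK : t * K ≤ 1 / 2)
    (htε : t * (M ^ 2 + M' * (M + 1)) ≤ ε / 2) :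
    c ≤ 1 - t + t * (ε + M' * (ε + ((1 + t * K) ^ 2 + 1 - 2 * c) / (4 * ε))) ∧
    c⁻¹ ≤ 1 + t + t * (ε + M' * (ε + ((1 + t * K) ^ 2 + 1 - 2 * c) / (4 * ε))) +
      2 * (t * K) ^ 2 := by
  obtain ⟨g, hg, hg0, hgG⟩ := exists_diffContOnCl_of_exterior hol hcl hexp
  have hM : 0 ≤ M := (norm_nonneg _).trans (hpM 1 (by simp))
  have htM : t * M ≤ 1 / 2 := by nlinarith
  have hconj : Set.MapsTo conj (closedBall (0 : ℂ) 1) (closedBall 0 1) := fun z hz => by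
    simpa using hz
  have hP : DiffContOnCl ℂ (fun w => conj (p (conj w))) (ball 0 1) := by
    refine DiffContOnCl.mk_ball (fun w hw => ?_) ?_
    · have hw' : conj w ∈ ball (0 : ℂ) 1 := by simpa using hw
      exact (differentiableAt_conj_conj_iff.2
        (hp.differentiableAt isOpen_ball hw')).differentiableWithinAt
    · exact Complex.continuous_conj.comp_continuousOn
        (hp.continuousOn_ball.comp Complex.continuous_conj.continuousOn hconj)
  refine center_bounds hg hP (by simp [hp0]) hg0 (fun w hw h => ?_) ht hε hε1 hM'
    (fun w hw => ?_) hK htK fun w hw => ?_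
  · rcases eq_or_ne w 0 with rfl | hw0
    · exact hc (by exact_mod_cast hg0.symm.trans h)
    · have hG : G w⁻¹ = f 0 := by
        rw [hgG w hw0] at h
        rw [hf0, (mul_eq_zero.1 h).resolve_left hw0]
      refine notMem_unbounded_component hf hinj (mem_ball_self one_pos) hx ?_
      rw [← honto, ← hG]
      refine Set.mem_image_of_mem _ ?_
      rw [Set.mem_ofPred_eq, norm_inv]
      exact (one_lt_inv₀ (norm_pos_iff.2 hw0)).2 (mem_ball_zero_iff.1 hw)
  · simpa using hpM (conj w) (by simpa using hw)
  · have hw1 : ‖w‖ = 1 := mem_sphere_zero_iff_norm.1 hw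
    have hw0 : w ≠ 0 := norm_pos_iff.1 (by simp [hw1])
    have hwc : w⁻¹ = conj w := Complex.inv_eq_conj hw1
    obtain ⟨ζ, hζ, hζG⟩ : G w⁻¹ ∈ f '' sphere 0 1 :=
      hweld ▸ Set.mem_image_of_mem _ (by simp [hw1])
    have hζ1 : ‖ζ‖ = 1 := mem_sphere_zero_iff_norm.1 hζ
    have hζf := hfp ζ (sphere_subset_closedBall hζ)
    have hgn : ‖g w‖ = ‖f ζ‖ := by rw [hgG w hw0, norm_mul, hw1, one_mul, hζG]
    have h1 : |‖f ζ‖ - ‖1 - t * p ζ‖| ≤ ε / 2 * t := by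
      have := (abs_norm_sub_norm_le (f ζ) (ζ * (1 - t * p ζ))).trans hζf
      rwa [norm_mul, hζ1, one_mul] at this
    have h2 := abs_norm_one_sub_mul_sub_le ht.le (hpM ζ hζ) htM
    have h3 : ‖g w - 1‖ = ‖f ζ - conj w‖ := by
      have : g w - 1 = w * (f ζ - conj w) := by
        rw [hgG w hw0, hζG, ← hwc, mul_sub, mul_inv_cancel₀ hw0]
      rw [this, norm_mul, hw1, one_mul]
    have h4 : ‖ζ - conj w‖ ≤ t * (M + 1) + ‖g w - 1‖ := by
      have h5 : ‖t * (ζ * p ζ)‖ ≤ t * M := by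
        rw [norm_mul, norm_mul, hζ1, one_mul, Complex.norm_real, Real.norm_of_nonneg ht.le]
        exact mul_le_mul_of_nonneg_left (hpM ζ hζ) ht.le
      have h6 : ζ - conj w =
          t * (ζ * p ζ) - (f ζ - ζ * (1 - t * p ζ)) + (f ζ - conj w) := by ring
      rw [h6, h3]
      refine norm_add_le_of_le ((norm_sub_le _ _).trans ?_) le_rfl
      nlinarith
    have h7 : |(p ζ).re - (p (conj w)).re| ≤ M' * (t * (M + 1) + ‖g w - 1‖) := by
      rw [← Complex.sub_re]
      refine (Complex.abs_re_le_norm _).trans ?_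
      have := hpM'.norm_sub_le (sphere_subset_closedBall hζ)
        (hconj (sphere_subset_closedBall hw))
      rw [Real.coe_toNNReal _ hM'] at this
      exact this.trans (mul_le_mul_of_nonneg_left h4 hM')
    rw [hgn, Complex.conj_re, abs_le]
    rw [abs_le] at h1 h2 h7
    have h8 : t * (t * (M ^ 2 + M' * (M + 1))) ≤ t * (ε / 2) := by gcongr
    have h9 := mul_le_mul_of_nonneg_left h7.1 ht.le
    have h10 := mul_le_mul_of_nonneg_left h7.2 ht.le
    constructor <;> linarith

/-- A function vanishing at `0` whose exponentials satisfy two-sided bounds of capacity type has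
derivative `1` at `0`. -/
lemma deriv_eq_one_of_exp_bounds {τ : ℝ → ℝ} {d M' K : ℝ}
    (hd : HasDerivWithinAt τ d (Set.Ioi 0) 0) (h0 : τ 0 = 0)
    (h : ∀ ε > 0, ε ≤ 1 → ∀ᶠ t in 𝓝[>] (0 : ℝ),
      Real.exp (-τ t) ≤ 1 - t +
        t * (ε + M' * (ε + ((1 + t * K) ^ 2 + 1 - 2 * Real.exp (-τ t)) / (4 * ε))) ∧
      (Real.exp (-τ t))⁻¹ ≤ 1 + t +
        t * (ε + M' * (ε + ((1 + t * K) ^ 2 + 1 - 2 * Real.exp (-τ t)) / (4 * ε))) +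
        2 * (t * K) ^ 2) : d = 1 := by
  have hslope : ∀ {φ : ℝ → ℝ} {φ' : ℝ}, HasDerivWithinAt φ φ' (Set.Ioi 0) 0 → φ 0 = 1 →
      Tendsto (fun t => (φ t - 1) / t) (𝓝[>] 0) (𝓝 φ') := by
    intro φ φ' hφ hφ0
    rw [hasDerivWithinAt_iff_tendsto_slope, Set.sdiff_singleton_eq_self (by simp)] at hφ
    refine hφ.congr fun t => ?_
    rw [slope_def_field, hφ0, sub_zero]
  have hneg : Tendsto (fun t => (Real.exp (-τ t) - 1) / t) (𝓝[>] 0) (𝓝 (-d)) :=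
    hslope (by simpa [h0] using hd.neg.exp) (by simp [h0])
  have hpos : Tendsto (fun t => ((Real.exp (-τ t))⁻¹ - 1) / t) (𝓝[>] 0) (𝓝 d) := by
    simp only [Real.exp_neg, inv_inv]
    exact hslope (by simpa [h0] using hd.exp) (by simp [h0])
  have hid : Tendsto (fun t : ℝ => t) (𝓝[>] 0) (𝓝 0) := tendsto_id.mono_left nhdsWithin_le_nhds
  have hexp : Tendsto (fun t => Real.exp (-τ t)) (𝓝[>] 0) (𝓝 1) := by
    have := hd.neg.exp.continuousWithinAt.tendsto
    simpa [h0] using this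
  have herr : ∀ ε > 0, Tendsto
      (fun t => ε + M' * (ε + ((1 + t * K) ^ 2 + 1 - 2 * Real.exp (-τ t)) / (4 * ε)))
      (𝓝[>] 0) (𝓝 (ε + M' * ε)) := by
    intro ε hε
    have h1 := ((((((hid.mul_const K).const_add 1).pow 2).add_const 1).sub
      (hexp.const_mul 2)).div_const (4 * ε))
    have h2 := ((h1.const_add ε).const_mul M').const_add ε
    convert h2 using 2
    ring
  have hup : ∀ ε > 0, ε ≤ 1 → 1 ≤ d + (ε + M' * ε) ∧ d ≤ 1 + (ε + M' * ε) := by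
    intro ε hε hε1
    constructor
    · have := le_of_tendsto_of_tendsto hneg ((herr ε hε).const_add (-1)) <| by
        filter_upwards [h ε hε hε1, self_mem_nhdsWithin] with t h1 ht
        rw [div_le_iff₀ ht]
        linarith [h1.1]
      linarith
    · have h2 := ((herr ε hε).const_add 1).add (hid.mul_const (2 * K ^ 2))
      rw [zero_mul, add_zero] at h2
      refine le_of_tendsto_of_tendsto hpos h2 ?_
      filter_upwards [h ε hε hε1, self_mem_nhdsWithin] with t h1 ht
      rw [div_le_iff₀ ht]
      linarith [h1.2]
  have hlim : Tendsto (fun ε : ℝ => ε + M' * ε) (𝓝[>] 0) (𝓝 0) := by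
    simpa using hid.add (hid.const_mul M')
  have hev : ∀ᶠ ε in 𝓝[>] (0 : ℝ), ε ∈ Set.Ioc 0 1 := Ioc_mem_nhdsGT one_pos
  refine le_antisymm ?_ ?_
  · have h3 := hlim.const_add 1
    rw [add_zero] at h3
    exact ge_of_tendsto h3 (hev.mono fun ε hε => (hup ε hε.1 hε.2).2)
  · have h3 := hlim.const_add d
    rw [add_zero] at h3
    exact ge_of_tendsto h3 (hev.mono fun ε hε => (hup ε hε.1 hε.2).1)

/- STATEMENT 17: In the welding setting of Theorem 1 (interior Löwner–Kufarev
maps f(z,t) = e^{-t}z + …, exterior maps F(z,τ) = e^{-τ}z + b₀(τ) + … of 𝔻*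
onto the unbounded complementary component of Γ(t) with F(𝕋,τ(t)) = f(𝕋,t),
τ differentiable at 0 with τ(0) = 0), the time change τ satisfies τ'(0) = 1;
equivalently τ(t) = t + o(t) as t → 0+. -/
theorem loewner_kufarev_welding_time_change_derivative
    (T : ℝ) (hT : 0 < T) (p p' p'' : ℂ → ℝ → ℂ)
    -- Carathéodory class driving function, C² on 𝔻̄, continuous in t,
    -- with p, p', p'' bounded on 𝔻̄ × [0,T)
    (hp_hol : ∀ t ∈ Set.Ico (0:ℝ) T,
      DifferentiableOn ℂ (fun z => p z t) (Metric.ball (0:ℂ) 1))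
    (hp_cont : ∀ t ∈ Set.Ico (0:ℝ) T,
      ContinuousOn (fun z => p z t) (Metric.closedBall (0:ℂ) 1))
    (hp_one : ∀ t ∈ Set.Ico (0:ℝ) T, p 0 t = 1)
    (hp_re : ∀ t ∈ Set.Ico (0:ℝ) T, ∀ z ∈ Metric.ball (0:ℂ) 1, 0 < (p z t).re)
    (hp' : ∀ t ∈ Set.Ico (0:ℝ) T, ∀ z ∈ Metric.ball (0:ℂ) 1,
      HasDerivAt (fun x => p x t) (p' z t) z)
    (hp'' : ∀ t ∈ Set.Ico (0:ℝ) T, ∀ z ∈ Metric.ball (0:ℂ) 1,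
      HasDerivAt (fun x => p' x t) (p'' z t) z)
    (hp'_cont : ∀ t ∈ Set.Ico (0:ℝ) T,
      ContinuousOn (fun z => p' z t) (Metric.closedBall (0:ℂ) 1))
    (hp''_cont : ∀ t ∈ Set.Ico (0:ℝ) T,
      ContinuousOn (fun z => p'' z t) (Metric.closedBall (0:ℂ) 1))
    (hp_t : ∀ z ∈ Metric.closedBall (0:ℂ) 1, ContinuousOn (fun t => p z t) (Set.Ico 0 T))
    (M M' M'' : ℝ)
    (hp_bdd : ∀ z ∈ Metric.closedBall (0:ℂ) 1, ∀ t ∈ Set.Ico (0:ℝ) T, ‖p z t‖ ≤ M)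
    (hp'_bdd : ∀ z ∈ Metric.closedBall (0:ℂ) 1, ∀ t ∈ Set.Ico (0:ℝ) T, ‖p' z t‖ ≤ M')
    (hp''_bdd : ∀ z ∈ Metric.closedBall (0:ℂ) 1, ∀ t ∈ Set.Ico (0:ℝ) T, ‖p'' z t‖ ≤ M'')
    -- interior maps: f solves the Löwner–Kufarev PDE, f(z,0) = z, each f(·,t)
    -- univalent on 𝔻 and continuous on 𝔻̄
    (f fz : ℂ → ℝ → ℂ)
    (hf_init : ∀ z ∈ Metric.ball (0:ℂ) 1, f z 0 = z)
    (hf_hol : ∀ t ∈ Set.Ico (0:ℝ) T,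
      DifferentiableOn ℂ (fun z => f z t) (Metric.ball (0:ℂ) 1))
    (hf_inj : ∀ t ∈ Set.Ico (0:ℝ) T,
      Set.InjOn (fun z => f z t) (Metric.ball (0:ℂ) 1))
    (hf_cl : ∀ t ∈ Set.Ico (0:ℝ) T,
      ContinuousOn (fun z => f z t) (Metric.closedBall (0:ℂ) 1))
    (hfz : ∀ t ∈ Set.Ico (0:ℝ) T, ∀ z ∈ Metric.ball (0:ℂ) 1,
      HasDerivAt (fun x => f x t) (fz z t) z)
    (hf_pde : ∀ z ∈ Metric.ball (0:ℂ) 1, ∀ t ∈ Set.Ico (0:ℝ) T,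
      HasDerivWithinAt (fun u => f z u) (-(z * fz z t * p z t)) (Set.Ico 0 T) t)
    -- Ω*(t): the unbounded connected component of the complement of
    -- Γ(t) = f(𝕋,t)
    (Ωstar : ℝ → Set ℂ)
    (hΩstar : ∀ t ∈ Set.Ico (0:ℝ) T, ∃ x : ℂ,
      ¬ Bornology.IsBounded
        (connectedComponentIn ((fun z => f z t) '' Metric.sphere (0:ℂ) 1)ᶜ x) ∧
      Ωstar t = connectedComponentIn ((fun z => f z t) '' Metric.sphere (0:ℂ) 1)ᶜ x)
    -- the time change τ, differentiable with τ(0) = 0 and τ' > 0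
    (τ τd : ℝ → ℝ)
    (hτ_init : τ 0 = 0)
    (hτd : ∀ t ∈ Set.Ico (0:ℝ) T, HasDerivWithinAt τ (τd t) (Set.Ico 0 T) t)
    (hτd_pos : ∀ t ∈ Set.Ico (0:ℝ) T, 0 < τd t)
    -- exterior maps: F(·,τ(t)) maps 𝔻* = {|z| > 1} injectively and
    -- holomorphically onto Ω*(t), extends continuously to 𝕋 with
    -- F(𝕋,τ(t)) = f(𝕋,t), and F(z,τ) = e^{-τ}z + b₀(τ) + O(1/z) at ∞
    (F Fz : ℂ → ℝ → ℂ) (b₀ : ℝ → ℂ)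
    (hF_hol : ∀ t ∈ Set.Ico (0:ℝ) T,
      DifferentiableOn ℂ (fun z => F z (τ t)) {z : ℂ | 1 < ‖z‖})
    (hF_inj : ∀ t ∈ Set.Ico (0:ℝ) T,
      Set.InjOn (fun z => F z (τ t)) {z : ℂ | 1 < ‖z‖})
    (hF_onto : ∀ t ∈ Set.Ico (0:ℝ) T,
      (fun z => F z (τ t)) '' {z : ℂ | 1 < ‖z‖} = Ωstar t)
    (hF_cl : ∀ t ∈ Set.Ico (0:ℝ) T,
      ContinuousOn (fun z => F z (τ t)) {z : ℂ | 1 ≤ ‖z‖})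
    (hF_exp : ∀ t ∈ Set.Ico (0:ℝ) T,
      Tendsto (fun z : ℂ => F z (τ t) - Complex.exp (-(τ t : ℂ)) * z)
        (Bornology.cobounded ℂ) (𝓝 (b₀ (τ t))))
    (hF_weld_set : ∀ t ∈ Set.Ico (0:ℝ) T,
      (fun z => F z (τ t)) '' Metric.sphere (0:ℂ) 1 =
        (fun z => f z t) '' Metric.sphere (0:ℂ) 1)
    (hFz : ∀ t ∈ Set.Ico (0:ℝ) T, ∀ z ∈ {z : ℂ | 1 < ‖z‖},
      HasDerivAt (fun x => F x (τ t)) (Fz z (τ t)) z)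
    -- exterior Löwner–Kufarev equation with driving function q, holomorphic on
    -- 𝔻*, q(z,t) → 1 as z → ∞, Re q > 0 on 𝔻*
    (q : ℂ → ℝ → ℂ)
    (hq_hol : ∀ t ∈ Set.Ico (0:ℝ) T,
      DifferentiableOn ℂ (fun z => q z t) {z : ℂ | 1 < ‖z‖})
    (hq_lim : ∀ t ∈ Set.Ico (0:ℝ) T,
      Tendsto (fun z => q z t) (Bornology.cobounded ℂ) (𝓝 1))
    (hq_re : ∀ t ∈ Set.Ico (0:ℝ) T, ∀ z ∈ {z : ℂ | 1 < ‖z‖}, 0 < (q z t).re)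
    (hF_pde : ∀ z ∈ {z : ℂ | 1 < ‖z‖}, ∀ t ∈ Set.Ico (0:ℝ) T,
      HasDerivWithinAt (fun u => F z (τ u))
        (-(z * Fz z (τ t) * q z t * τd t)) (Set.Ico 0 T) t) :
    τd 0 = 1 ∧ (fun t : ℝ => τ t - t) =o[𝓝[>] (0:ℝ)] (fun t : ℝ => t) := by
  have h00 : (0 : ℝ) ∈ Set.Ico 0 T := ⟨le_rfl, hT⟩
  have hc0 : (0 : ℂ) ∈ Metric.closedBall (0 : ℂ) 1 := Metric.mem_closedBall_self zero_le_one
  have hb0 : (0 : ℂ) ∈ Metric.ball (0 : ℂ) 1 := Metric.mem_ball_self one_pos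
  have hM' : 0 ≤ M' := (norm_nonneg _).trans (hp'_bdd 0 hc0 0 h00)
  have hf0 : ∀ t ∈ Set.Ico (0 : ℝ) T, f 0 t = 0 := by
    intro t ht
    have := (convex_Ico 0 T).norm_image_sub_le_of_norm_hasDerivWithin_le (C := 0)
      (hf_pde 0 hb0) (fun s _ => by simp) h00 ht
    simpa [hf_init 0 hb0] using this
  have hle : 𝓝[>] (0 : ℝ) ≤ 𝓝[Set.Ico 0 T] 0 :=
    nhdsWithin_le_iff.2 (mem_of_superset (Ioo_mem_nhdsGT hT) Set.Ioo_subset_Ico_self)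
  have hdτ : HasDerivWithinAt τ (τd 0) (Set.Ioi 0) 0 :=
    (hτd 0 h00).mono_of_mem_nhdsWithin (hle self_mem_nhdsWithin)
  have hd : τd 0 = 1 := by
    refine deriv_eq_one_of_exp_bounds (M' := M') (K := M + 1 + 3 * M') hdτ hτ_init ?_
    intro ε hε hε1
    have hsmall : ∀ A : ℝ, ∀ η > 0, ∀ᶠ t in 𝓝[>] (0 : ℝ), t * A ≤ η := by
      intro A η hη
      have : Tendsto (fun t : ℝ => t * A) (𝓝 0) (𝓝 (0 * A)) := tendsto_id.mul_const _
      rw [zero_mul] at this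
      exact nhdsWithin_le_nhds ((this.eventually_lt_const hη).mono fun t ht => ht.le)
    filter_upwards [loewner_kufarev_expansion hT hp_cont hp_re hp' hp_t hp_bdd hp'_bdd hf_init
      hf_inj hf_cl hfz hf_pde (half_pos hε), hsmall (M + 1 + 3 * M') (1 / 2) one_half_pos,
      hsmall (M ^ 2 + M' * (M + 1)) (ε / 2) (half_pos hε), Ioo_mem_nhdsGT hT]
      with t hft htK htε ht
    have htT : t ∈ Set.Ico 0 T := Set.Ioo_subset_Ico_self ht
    obtain ⟨x, hx, hΩ⟩ := hΩstar t htT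
    refine capacity_bounds (b := b₀ (τ t)) (.mk_ball (hf_hol t htT) (hf_cl t htT))
      (hf_inj t htT) (hf0 t htT) (.mk_ball (hp_hol 0 h00) (hp_cont 0 h00)) (hp_one 0 h00)
      (fun z hz => hp_bdd z (Metric.sphere_subset_closedBall hz) 0 h00)
      (lipschitzOnWith_closedBall_of_norm_deriv_le (hp' 0 h00) (hp_cont 0 h00)
        fun z hz => hp'_bdd z (Metric.ball_subset_closedBall hz) 0 h00)
      hM' hft (hF_hol t htT) (hF_cl t htT) ?_ (Real.exp_ne_zero _) hx
      ((hF_onto t htT).trans hΩ) (hF_weld_set t htT) ht.1 hε hε1 rfl htK htε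
    simpa using hF_exp t htT
  refine ⟨hd, ?_⟩
  have := hasDerivWithinAt_iff_isLittleO.1 hdτ
  simpa [hd, hτ_init] using this
end
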